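/- Let T = {T_1, T_2} be two (not necessarily binary) rooted phylogenetic trees on a finite taxa set X, let C = Cl(T), and let U ⊆ X be an unseparated set with respect to C. Then r(C) = r(C|U) + r(C_{U→u}). -/

import Mathlib

open scoped Classical

namespace Phylo

variable {α : Type} [DecidableEq α]

/-- A finite directed graph whose vertices carry labels from `α`; used to model
rooted phylogenetic networks and trees. -/
structure Net (α : Type) where
  n : ℕ
  E : Finset (Fin n × Fin n)
  label : Fin n → α

namespace Net

def indeg (N : Net α) (v : Fin N.n) : ℕ := (N.E.filter fun e => e.2 = v).card

def outdeg (N : Net α) (v : Fin N.n) : ℕ := (N.E.filter fun e => e.1 = v).card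

def Adj (N : Net α) (u v : Fin N.n) : Prop := (u, v) ∈ N.E

def Reaches (N : Net α) : Fin N.n → Fin N.n → Prop := Relation.ReflTransGen N.Adj

def IsLeaf (N : Net α) (v : Fin N.n) : Prop := N.outdeg v = 0

/-- The set of labels of leaves reachable from `v` by directed paths. -/
noncomputable def clusterBelow (N : Net α) (v : Fin N.n) : Finset α :=
  (Finset.univ.filter fun w => N.Reaches v w ∧ N.IsLeaf w).image N.label

/-- The reticulation number `r(N) = Σ_{v : indeg(v) > 0} (indeg(v) - 1)`. -/
def reticNum (N : Net α) : ℕ := ∑ v, (N.indeg v - 1)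

end Net

/-- `N` is a rooted phylogenetic network on the taxa set `X`: an acyclic digraph with a
unique root (indegree-0 node), no node with indegree 1 and outdegree 1, every
reticulation (indegree ≥ 2) having outdegree ≥ 1, and leaves bijectively labeled by `X`. -/
def IsPhyloNet (X : Finset α) (N : Net α) : Prop :=
  (∀ v : Fin N.n, ¬ Relation.TransGen N.Adj v v) ∧
  (∃! ρ : Fin N.n, N.indeg ρ = 0) ∧
  (∀ v : Fin N.n, ¬ (N.indeg v = 1 ∧ N.outdeg v = 1)) ∧
  (∀ v : Fin N.n, 2 ≤ N.indeg v → 1 ≤ N.outdeg v) ∧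
  Set.BijOn N.label {v | N.IsLeaf v} (X : Set α)

/-- A rooted phylogenetic tree on `X` is a network on `X` with reticulation number 0. -/
def IsPhyloTree (X : Finset α) (N : Net α) : Prop := IsPhyloNet X N ∧ N.reticNum = 0

/-- A network is binary if every reticulation has indegree 2 and outdegree 1 and every
non-leaf tree node has outdegree 2. -/
def IsBinary (N : Net α) : Prop :=
  ∀ v : Fin N.n, (N.indeg v ≤ 1 → N.outdeg v = 0 ∨ N.outdeg v = 2) ∧
    (2 ≤ N.indeg v → N.indeg v = 2 ∧ N.outdeg v = 1)

/-- The internal vertices of a path given as a list of vertices. -/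
def internals {β : Type*} (p : List β) : List β := p.tail.dropLast

def IsDirPath (N : Net α) (u v : Fin N.n) (p : List (Fin N.n)) : Prop :=
  p.head? = some u ∧ p.getLast? = some v ∧ p.Chain' N.Adj ∧ 2 ≤ p.length

/-- `N` displays `T`: `T` can be obtained from `N` by deleting nodes and edges and
suppressing indegree-1 outdegree-1 nodes, formalized as a topological embedding:
each edge of `T` maps to a directed path of `N`, paths being internally disjoint
from each other and from the images of the nodes of `T`, and leaves of `T` map to
leaves of `N` with the same label. -/
def Displays (N T : Net α) : Prop :=
  ∃ φ : Fin T.n → Fin N.n, Function.Injective φ ∧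
    (∀ v, T.IsLeaf v → N.IsLeaf (φ v) ∧ N.label (φ v) = T.label v) ∧
    ∃ P : Fin T.n × Fin T.n → List (Fin N.n),
      (∀ e ∈ T.E, IsDirPath N (φ e.1) (φ e.2) (P e)) ∧
      (∀ e ∈ T.E, ∀ w ∈ internals (P e), w ∉ Set.range φ) ∧
      (∀ e ∈ T.E, ∀ f ∈ T.E, e ≠ f → ∀ w ∈ internals (P e), w ∉ internals (P f))

/-- `N` represents the cluster `C` in the softwired sense: some tree on `X` displayed by
`N` has an edge whose set of leaf descendants is exactly `C`. -/
def RepresentsCluster (X : Finset α) (N : Net α) (C : Finset α) : Prop :=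
  ∃ T : Net α, IsPhyloTree X T ∧ Displays N T ∧ ∃ e ∈ T.E, T.clusterBelow e.2 = C

def RepresentsSet (X : Finset α) (N : Net α) (𝒞 : Set (Finset α)) : Prop :=
  ∀ C ∈ 𝒞, RepresentsCluster X N C

/-- `Cl(T)`: the set of clusters represented by edges of the tree `T`. -/
def clSet (T : Net α) : Set (Finset α) := {C | ∃ e ∈ T.E, T.clusterBelow e.2 = C}

/-- `r(𝒞)`: the minimum reticulation number of a network on `X` representing `𝒞`. -/
noncomputable def rNum (X : Finset α) (𝒞 : Set (Finset α)) : ℕ :=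
  sInf {k | ∃ N : Net α, IsPhyloNet X N ∧ RepresentsSet X N 𝒞 ∧ N.reticNum = k}

/-- A cluster on `X` is a nonempty proper subset of `X`. -/
def IsCluster (X C : Finset α) : Prop := C ⊆ X ∧ C.Nonempty ∧ C ≠ X

def IsClusterSet (X : Finset α) (𝒞 : Set (Finset α)) : Prop := ∀ C ∈ 𝒞, IsCluster X C

def Compatible (A B : Finset α) : Prop := A ∩ B = ∅ ∨ A ⊆ B ∨ B ⊆ A

/-- `𝒞 \ S`: remove the elements of `S` from each cluster, discarding emptied clusters. -/
def removeTaxa (𝒞 : Set (Finset α)) (S : Finset α) : Set (Finset α) :=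
  {D | D.Nonempty ∧ ∃ C ∈ 𝒞, D = C \ S}

/-- `𝒞 | S`: the restriction of `𝒞` to `S`. -/
def restrictTo (𝒞 : Set (Finset α)) (S : Finset α) : Set (Finset α) :=
  {D | D.Nonempty ∧ ∃ C ∈ 𝒞, D = C ∩ S}

/-- `S` is unseparated by `𝒞`: no cluster of `𝒞` is incompatible with `S`. -/
def Unseparated (𝒞 : Set (Finset α)) (S : Finset α) : Prop := ∀ C ∈ 𝒞, Compatible C S

/-- `𝒞` separates every proper subset of `X` with at least two elements. -/
def Separating (X : Finset α) (𝒞 : Set (Finset α)) : Prop :=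
  ∀ X' : Finset α, X' ⊂ X → 2 ≤ X'.card → ∃ C ∈ 𝒞, ¬ Compatible C X'

def PairwiseCompatible (𝒞 : Set (Finset α)) : Prop := ∀ A ∈ 𝒞, ∀ B ∈ 𝒞, Compatible A B

/-- `S` is an ST-set with respect to `𝒞`. -/
def IsSTSet (X : Finset α) (𝒞 : Set (Finset α)) (S : Finset α) : Prop :=
  S ⊆ X ∧ Unseparated 𝒞 S ∧ PairwiseCompatible (restrictTo 𝒞 S)

/-- `S` is a maximal ST-set: no ST-set properly contains it. -/
def IsMaxSTSet (X : Finset α) (𝒞 : Set (Finset α)) (S : Finset α) : Prop :=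
  IsSTSet X 𝒞 S ∧ ∀ S', IsSTSet X 𝒞 S' → ¬ S ⊂ S'

/-- `(S₁, …, S_p)` is a maximal ST-set sequence of `𝒞`. -/
def IsMaxSTSeq : Finset α → Set (Finset α) → List (Finset α) → Prop
  | _, _, [] => True
  | X, 𝒞, S :: L => IsMaxSTSet X 𝒞 S ∧ IsMaxSTSeq (X \ S) (removeTaxa 𝒞 S) L

/-- `(S₁, …, S_p)` is an ST-set sequence of `𝒞` (empty ST-sets allowed). -/
def IsSTSeq : Finset α → Set (Finset α) → List (Finset α) → Prop
  | _, _, [] => True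
  | X, 𝒞, S :: L => IsSTSet X 𝒞 S ∧ IsSTSeq (X \ S) (removeTaxa 𝒞 S) L

def removeAll (𝒞 : Set (Finset α)) (L : List (Finset α)) : Set (Finset α) :=
  L.foldl removeTaxa 𝒞

/-- A maximal ST-set *tree* sequence: additionally the remaining clusters are pairwise
compatible. -/
def IsMaxSTTreeSeq (X : Finset α) (𝒞 : Set (Finset α)) (L : List (Finset α)) : Prop :=
  IsMaxSTSeq X 𝒞 L ∧ PairwiseCompatible (removeAll 𝒞 L)

def IsSTTreeSeq (X : Finset α) (𝒞 : Set (Finset α)) (L : List (Finset α)) : Prop :=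
  IsSTSeq X 𝒞 L ∧ PairwiseCompatible (removeAll 𝒞 L)

/-- The MST lower bound: minimum length of a maximal ST-set tree sequence of `𝒞`. -/
noncomputable def mstLB (X : Finset α) (𝒞 : Set (Finset α)) : ℕ :=
  sInf {p | ∃ L, IsMaxSTTreeSeq X 𝒞 L ∧ L.length = p}

/- Underlying undirected notions, biconnected components and the level of a network. -/

def uadj (N : Net α) (F : Finset (Fin N.n × Fin N.n)) (u v : Fin N.n) : Prop :=
  (u, v) ∈ F ∨ (v, u) ∈ F

def verts (N : Net α) (F : Finset (Fin N.n × Fin N.n)) : Finset (Fin N.n) :=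
  F.image Prod.fst ∪ F.image Prod.snd

def ConnOn (N : Net α) (F : Finset (Fin N.n × Fin N.n)) : Prop :=
  ∀ u ∈ verts N F, ∀ v ∈ verts N F, Relation.ReflTransGen (uadj N F) u v

def delVert (N : Net α) (F : Finset (Fin N.n × Fin N.n)) (v : Fin N.n) :
    Finset (Fin N.n × Fin N.n) :=
  F.filter fun e => e.1 ≠ v ∧ e.2 ≠ v

def HasCutNodeOn (N : Net α) (F : Finset (Fin N.n × Fin N.n)) : Prop :=
  ∃ v ∈ verts N F, ∃ a ∈ verts N F, ∃ b ∈ verts N F, a ≠ v ∧ b ≠ v ∧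
    ¬ Relation.ReflTransGen (uadj N (delVert N F v)) a b

/-- The (edge set of a) subgraph is biconnected: connected and without cut-nodes. -/
def Biconn (N : Net α) (F : Finset (Fin N.n × Fin N.n)) : Prop :=
  F.Nonempty ∧ ConnOn N F ∧ ¬ HasCutNodeOn N F

/-- `F` is a biconnected component of `N`: a maximal biconnected subgraph. -/
def IsBCC (N : Net α) (F : Finset (Fin N.n × Fin N.n)) : Prop :=
  F ⊆ N.E ∧ Biconn N F ∧ ∀ F', F' ⊆ N.E → Biconn N F' → F ⊆ F' → F' = F

/-- Reticulation number of a biconnected component, indegrees computed within it. -/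
def compRetic (N : Net α) (F : Finset (Fin N.n × Fin N.n)) : ℕ :=
  ∑ v ∈ verts N F, ((F.filter fun e => e.2 = v).card - 1)

/-- The level of `N`: the maximum reticulation number of a biconnected component. -/
noncomputable def level (N : Net α) : ℕ :=
  sSup {k | ∃ F, IsBCC N F ∧ compRetic N F = k}

def IsCutEdge (N : Net α) (e : Fin N.n × Fin N.n) : Prop :=
  e ∈ N.E ∧ ∃ a b : Fin N.n, ¬ Relation.ReflTransGen (uadj N (N.E.erase e)) a b

def IsCutNode (N : Net α) (v : Fin N.n) : Prop :=
  ∃ a b : Fin N.n, a ≠ v ∧ b ≠ v ∧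
    ¬ Relation.ReflTransGen (uadj N (delVert N N.E v)) a b

/-- `N` is simple: removal of any cut-node or cut-edge leaves at most one non-trivial
connected component (all remaining edges lie in a single component). -/
def IsSimpleNet (N : Net α) : Prop :=
  (∀ v : Fin N.n, IsCutNode N v → ∀ f ∈ delVert N N.E v, ∀ g ∈ delVert N N.E v,
      Relation.ReflTransGen (uadj N (delVert N N.E v)) f.1 g.1) ∧
  (∀ e : Fin N.n × Fin N.n, IsCutEdge N e → ∀ f ∈ N.E.erase e, ∀ g ∈ N.E.erase e,
      Relation.ReflTransGen (uadj N (N.E.erase e)) f.1 g.1)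

/-- The non-trivial ST-set `S` is under a cut-edge of `N`: `N` has a cut-edge `(u,v)`
such that the subnetwork rooted at `v` is a tree whose taxa set is `S` and which
represents the cluster set `𝒞 | S`. -/
def UnderCutEdge (𝒞 : Set (Finset α)) (N : Net α) (S : Finset α) : Prop :=
  ∃ e ∈ N.E, IsCutEdge N e ∧ N.clusterBelow e.2 = S ∧
    (∀ w : Fin N.n, N.Reaches e.2 w →
      (N.E.filter fun f => f.2 = w ∧ N.Reaches e.2 f.1).card ≤ 1) ∧
    ∀ C ∈ restrictTo 𝒞 S, ∃ f ∈ N.E, N.Reaches e.2 f.1 ∧ N.clusterBelow f.2 = C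

/-- The subnetwork of `N` rooted at `v` is exactly (isomorphic to) `T`. -/
def IsoSubnetAt (N : Net α) (v : Fin N.n) (T : Net α) : Prop :=
  ∃ g : Fin T.n → Fin N.n, Function.Injective g ∧
    Set.range g = {w | N.Reaches v w} ∧
    (∀ a b : Fin T.n, (a, b) ∈ T.E ↔ (g a, g b) ∈ N.E) ∧
    ∀ a : Fin T.n, T.IsLeaf a → N.label (g a) = T.label a

/-- `T` is a subtree below a reticulation (SBR) of `N`. -/
def IsSBR (N T : Net α) : Prop :=
  ∃ v : Fin N.n, 2 ≤ N.indeg v ∧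
    (∀ w : Fin N.n, N.Reaches v w → w ≠ v → N.indeg w < 2) ∧
    ((N.outdeg v = 1 ∧ ∃ c : Fin N.n, (v, c) ∈ N.E ∧ IsoSubnetAt N c T) ∨
     (N.outdeg v ≠ 1 ∧ IsoSubnetAt N v T))

/-- `T'` is a (not necessarily binary) refinement of `T`: a tree on `X` with
`Cl(T) ⊆ Cl(T')`. -/
def IsRefinement (X : Finset α) (T T' : Net α) : Prop :=
  IsPhyloTree X T' ∧ clSet T ⊆ clSet T'

/-- `h⁰(𝒯)`: minimum reticulation number of a network on `X` displaying some
refinement of each tree of the family. -/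
noncomputable def h0 (X : Finset α) {m : ℕ} (T : Fin m → Net α) : ℕ :=
  sInf {k | ∃ N : Net α, IsPhyloNet X N ∧
    (∀ i, ∃ T', IsRefinement X (T i) T' ∧ Displays N T') ∧ N.reticNum = k}

/-- `h⁻(𝒯)`: minimum reticulation number of a network on `X` displaying some *binary*
refinement of each tree of the family. -/
noncomputable def hminus (X : Finset α) {m : ℕ} (T : Fin m → Net α) : ℕ :=
  sInf {k | ∃ N : Net α, IsPhyloNet X N ∧
    (∀ i, ∃ T', IsRefinement X (T i) T' ∧ IsBinary T' ∧ Displays N T') ∧ N.reticNum = k}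

/-- `N` is consistent with the rooted triplet `xy|z`: it displays the binary tree on
`{x,y,z}` in which `{x,y}` is a cluster. -/
def ConsistentTriplet (N : Net α) (x y z : α) : Prop :=
  ∃ t : Net α, IsPhyloTree ({x, y, z} : Finset α) t ∧ IsBinary t ∧
    (∃ e ∈ t.E, t.clusterBelow e.2 = ({x, y} : Finset α)) ∧ Displays N t

/-- `r_tr(𝒯)`: minimum reticulation number of a network on `X` consistent with every
rooted triplet consistent with some tree of the family. -/
noncomputable def rtr (X : Finset α) {m : ℕ} (T : Fin m → Net α) : ℕ :=
  sInf {k | ∃ N : Net α, IsPhyloNet X N ∧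
    (∀ x y z : α, x ≠ y → y ≠ z → x ≠ z →
      (∃ i, ConsistentTriplet (T i) x y z) → ConsistentTriplet N x y z) ∧
    N.reticNum = k}

/-- `𝒞_{U → u}`: replace all elements of `U` in every cluster by the single taxon `u`. -/
def collapseTo (𝒞 : Set (Finset α)) (U : Finset α) (u : α) : Set (Finset α) :=
  {D | ∃ C ∈ 𝒞, D = if (C ∩ U).Nonempty then (C \ U) ∪ {u} else C}

set_option linter.unusedSectionVars false
set_option linter.unusedVariables false
set_option linter.deprecated false

/-- relative compatibility, elementwise -/
def Cpt (X A B : Finset α) : Prop :=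
  (∀ x ∈ X, x ∈ A → x ∈ B) ∨ (∀ x ∈ X, x ∈ B → x ∈ A) ∨ (∀ x ∈ X, x ∈ A → x ∉ B)

def PP (𝒞 : Set (Finset α)) : ℕ → Finset α → Prop
  | 0, X => ∀ A ∈ 𝒞, ∀ B ∈ 𝒞, Cpt X A B
  | k+1, X => ∃ S ⊆ X, (∀ A ∈ 𝒞, Cpt X A S) ∧ (∀ A ∈ 𝒞, ∀ B ∈ 𝒞, Cpt S A B) ∧ PP 𝒞 k (X \ S)

lemma Cpt.mono {X Y A B : Finset α} (h : Cpt X A B) (hY : Y ⊆ X) : Cpt Y A B := by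
  rcases h with h | h | h
  · exact Or.inl fun x hx => h x (hY hx)
  · exact Or.inr (Or.inl fun x hx => h x (hY hx))
  · exact Or.inr (Or.inr fun x hx => h x (hY hx))

lemma Cpt.symm {X A B : Finset α} (h : Cpt X A B) : Cpt X B A := by
  rcases h with h | h | h
  · exact Or.inr (Or.inl h)
  · exact Or.inl h
  · exact Or.inr (Or.inr fun x hx h1 h2 => h x hx h2 h1)

/-- pulled back compatibility -/
lemma Cpt.pull {X Y A B A' B' : Finset α} (f : α → α) (hf : ∀ y ∈ Y, f y ∈ X)
    (h : Cpt X A B) (hA : ∀ y ∈ Y, y ∈ A' ↔ f y ∈ A) (hB : ∀ y ∈ Y, y ∈ B' ↔ f y ∈ B) :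
    Cpt Y A' B' := by
  rcases h with h | h | h
  · exact Or.inl fun x hx h1 => (hB x hx).2 (h _ (hf x hx) ((hA x hx).1 h1))
  · exact Or.inr (Or.inl fun x hx h1 => (hA x hx).2 (h _ (hf x hx) ((hB x hx).1 h1)))
  · exact Or.inr (Or.inr fun x hx h1 h2 => h _ (hf x hx) ((hA x hx).1 h1) ((hB x hx).1 h2))

lemma Cpt.small {X A : Finset α} (B : Finset α)
    (h : ∀ x ∈ X, ∀ y ∈ X, x ∈ A → y ∈ A → x = y) : Cpt X A B := by
  by_cases h' : ∃ x ∈ X, x ∈ A ∧ x ∈ B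
  · obtain ⟨x, hx, hA, hB⟩ := h'
    left; intro y hy hyA
    rw [h y hy x hx hyA hA]; exact hB
  · right; right; intro x hx h1 h2; exact h' ⟨x, hx, h1, h2⟩

lemma PP.pull {𝒞 𝒟 : Set (Finset α)} (f : α → α) : ∀ (k : ℕ) (X Y : Finset α),
    (∀ y ∈ Y, f y ∈ X) →
    (∀ A ∈ 𝒟, (∀ x ∈ Y, ∀ y ∈ Y, x ∈ A → y ∈ A → x = y) ∨ ∃ A' ∈ 𝒞, ∀ y ∈ Y, y ∈ A ↔ f y ∈ A') →
    PP 𝒞 k X → PP 𝒟 k Y := by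
  intro k
  induction k with
  | zero =>
    intro X Y hf h hP A hA B hB
    rcases h A hA with h1 | ⟨A', hA', h1⟩
    · exact Cpt.small _ h1
    rcases h B hB with h2 | ⟨B', hB', h2⟩
    · exact (Cpt.small _ h2).symm
    exact (hP A' hA' B' hB').pull f hf h1 h2
  | succ k ih =>
    rintro X Y hf h ⟨S, hS, h1, h2, h3⟩
    refine ⟨Y.filter fun y => f y ∈ S, Finset.filter_subset _ _, ?_, ?_, ?_⟩
    · intro A hA
      rcases h A hA with h4 | ⟨A', hA', h4⟩
      · exact Cpt.small _ h4
      · refine (h1 A' hA').pull f hf h4 ?_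
        intro y hy; simp [hy]
    · intro A hA B hB
      rcases h A hA with h4 | ⟨A', hA', h4⟩
      · exact Cpt.small _ (by grind)
      rcases h B hB with h5 | ⟨B', hB', h5⟩
      · exact (Cpt.small _ (by grind)).symm
      refine (h2 A' hA' B' hB').pull f ?_ ?_ ?_ <;> grind
    · refine ih (X \ S) _ ?_ ?_ h3
      · grind
      · intro A hA
        rcases h A hA with h4 | ⟨A', hA', h4⟩
        · left; grind
        · right; exact ⟨A', hA', by grind⟩

lemma PP.subset {𝒞 : Set (Finset α)} {k : ℕ} {X Y : Finset α} (h : PP 𝒞 k X) (hY : Y ⊆ X) :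
    PP 𝒞 k Y := 
  PP.pull id k X Y (fun y hy => hY hy) (fun A hA => Or.inr ⟨A, hA, fun _ _ => Iff.rfl⟩) h

lemma PP.succ {𝒞 : Set (Finset α)} {k : ℕ} {X : Finset α} (h : PP 𝒞 k X) : PP 𝒞 (k+1) X := by
  refine ⟨∅, by simp, ?_, ?_, by simpa using h⟩
  · intro A hA; exact Or.inr (Or.inl (by simp))
  · intro A hA B hB; exact Or.inl (by simp)

lemma PP.mono {𝒞 : Set (Finset α)} {k l : ℕ} {X : Finset α} (h : PP 𝒞 k X) (hl : k ≤ l) :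
    PP 𝒞 l X := by
  induction hl with
  | refl => exact h
  | step _ ih => exact ih.succ

lemma cpt_glue0 {B D A A' : Finset α}
    (h1 : Cpt B A A') (h2 : Cpt D A A')
    (h3 : (∀ x ∈ D, x ∉ A) ∨ (∀ x ∈ B, x ∉ A) ∨ (∀ x ∈ D ∪ B, x ∈ A))
    (h4 : (∀ x ∈ D, x ∉ A') ∨ (∀ x ∈ B, x ∉ A') ∨ (∀ x ∈ D ∪ B, x ∈ A')) :
    Cpt (D ∪ B) A A' := by
  unfold Cpt at *
  simp only [Finset.mem_union] at *
  rcases h3 with h3 | h3 | h3 <;> rcases h4 with h4 | h4 | h4 <;>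
    rcases h1 with h1 | h1 | h1 <;> rcases h2 with h2 | h2 | h2 <;>
    first
    | (left; grind; done)
    | (right; left; grind; done)
    | (right; right; grind; done)

lemma cpt_glue1 {B D A S : Finset α} (hS : S ⊆ D) (hD : ∀ ⦃a⦄, a ∈ B → a ∉ D)
    (h3 : (∀ x ∈ D, x ∉ A) ∨ (∀ x ∈ B, x ∉ A) ∨ (∀ x ∈ D ∪ B, x ∈ A))
    (h2 : Cpt D A S) : Cpt (D ∪ B) A S := by
  unfold Cpt at *
  simp only [Finset.mem_union] at *
  rcases h3 with h3 | h3 | h3 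
  · right; right; intro x hx h h'; exact h3 x (hS h') h
  · rcases h2 with h2 | h2 | h2
    · left; grind
    · right; left; grind
    · right; right; grind
  · right; left; intro x hx h; exact h3 x hx

lemma cpt_sdiff {X A U : Finset α} (S : Finset α) (h : Cpt X A U) : Cpt (X \ S) A (U \ S) := by
  unfold Cpt at *
  simp only [Finset.mem_sdiff] at *
  rcases h with h | h | h
  · left; grind
  · right; left; grind
  · right; right; grind

lemma cpt_split1 {X A U S : Finset α} {s : α} (hS : S ⊆ X) (hUX : U ⊆ X) (hs : s ∈ S) (hs' : s ∉ U)
    (h4 : Cpt X A U) (h5 : Cpt X A S) :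
    (∀ x ∈ U \ S, x ∉ A) ∨ (∀ x ∈ U ∩ S, x ∉ A) ∨ (∀ x ∈ U \ S ∪ U ∩ S, x ∈ A) := by
  rcases h4 with h4 | h4 | h4
  · rcases h5 with h5 | h5 | h5
    · left; grind
    · exact absurd (h4 s (hS hs) (h5 s (hS hs) hs)) hs'
    · right; left; grind
  · right; right; grind
  · left; grind

lemma cpt_split2 {X A U S : Finset α} {v : α} (hS : S ⊆ X) (hUX : U ⊆ X) (hv : v ∈ U) (hv' : v ∉ S)
    (h4 : Cpt X A U) (h5 : Cpt X A S) : Cpt (X \ U ∪ {v}) A (S \ U) := by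
  rcases h4 with h4 | h4 | h4
  · right; right; grind
  · rcases h5 with h5 | h5 | h5
    · exact absurd (h5 v (hUX hv) (h4 v (hUX hv) hv)) hv'
    · right; left; grind
    · right; right; grind
  · rcases h5 with h5 | h5 | h5
    · left; grind
    · right; left; grind
    · right; right; grind

lemma unsep_cases {R U A : Finset α} {u : α} (h : Cpt (R ∪ U) A U) (hR : ∀ ⦃a⦄, a ∈ R → a ∉ U) :
    (∀ x ∈ R, x ∉ A) ∨ (∀ x ∈ U, x ∈ A) ∨ (∀ x ∈ U, x ∉ A) := by
  rcases h with h | h | h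
  · left; grind
  · right; left; grind
  · right; right; grind

lemma cpt_blow0 {R U A A' : Finset α} {u : α} (hu : u ∈ U) (hR : ∀ ⦃a⦄, a ∈ R → a ∉ U)
    (h1 : Cpt U A A') (h2 : Cpt (R ∪ {u}) A A') (h3 : Cpt (R ∪ U) A U) (h4 : Cpt (R ∪ U) A' U) :
    Cpt (R ∪ U) A A' := by
  have h3 := unsep_cases (u := u) h3 hR
  have h4 := unsep_cases (u := u) h4 hR
  unfold Cpt at *
  simp only [Finset.mem_union, Finset.mem_singleton] at *
  rcases h3 with h3 | h3 | h3 <;> rcases h4 with h4 | h4 | h4 <;>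
    rcases h1 with h1 | h1 | h1 <;> rcases h2 with h2 | h2 | h2 <;>
    first
    | (left; grind; done)
    | (right; left; grind; done)
    | (right; right; grind; done)

lemma cpt_blow1 {R U A S : Finset α} {u : α} (hu : u ∈ U) (hR : ∀ ⦃a⦄, a ∈ R → a ∉ U) (hs : u ∈ S)
    (h5 : Cpt (R ∪ {u}) A S) (h3 : Cpt (R ∪ U) A U)  :
    Cpt (R ∪ U) A (S ∪ U) := by
  have h3 := unsep_cases (u := u) h3 hR
  unfold Cpt at *
  simp only [Finset.mem_union, Finset.mem_singleton] at *
  rcases h3 with h3 | h3 | h3 <;> rcases h5 with h2 | h2 | h2 <;>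
    first
    | (left; grind; done)
    | (right; left; grind; done)
    | (right; right; grind; done)

lemma cpt_blow2 {R U A S : Finset α} {u : α} (hu : u ∈ U) (hR : ∀ ⦃a⦄, a ∈ R → a ∉ U) (hs : u ∉ S)
    (hS : S ⊆ R ∪ {u})
    (h5 : Cpt (R ∪ {u}) A S) (h3 : Cpt (R ∪ U) A U)  :
    Cpt (R ∪ U) A S := by
  have h3 := unsep_cases (u := u) h3 hR
  have hS' : ∀ x ∈ S, x ∈ R := by grind
  unfold Cpt at *
  simp only [Finset.mem_union, Finset.mem_singleton] at *
  rcases h3 with h3 | h3 | h3 <;> rcases h5 with h2 | h2 | h2 <;>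
    first
    | (left; grind; done)
    | (right; left; grind; done)
    | (right; right; grind; done)

lemma cpt_join {X U A S : Finset α} {v : α} (hUX : U ⊆ X) (hS : S ⊆ U) (hv : v ∈ U) (hv' : v ∉ S)
    (h4 : Cpt X A U) (h5 : Cpt U A S) : Cpt X A S := by
  unfold Cpt at *
  rcases h4 with h3 | h3 | h3 <;> rcases h5 with h2 | h2 | h2 <;>
    first
    | (left; grind; done)
    | (right; left; grind; done)
    | (right; right; grind; done)

lemma PP.exists (𝒞 : Set (Finset α)) (X : Finset α) : ∃ k, PP 𝒞 k X := by
  induction X using Finset.induction_on with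
  | empty => exact ⟨0, fun A _ B _ => Or.inl (by simp)⟩
  | insert x X hx ih =>
    obtain ⟨k, hk⟩ := ih
    refine ⟨k+1, {x}, by simp, ?_, ?_, hk.subset (by grind)⟩
    · intro A hA; exact (Cpt.small _ (by grind)).symm
    · intro A hA B hB; exact Cpt.small _ (by simp)

lemma PP.change {𝒞 : Set (Finset α)} {k : ℕ} {R U : Finset α} {u v : α} (hu : u ∈ U) (hv : v ∈ U)
    (hU : ∀ A ∈ 𝒞, Cpt (R ∪ U) A U) (hR : Disjoint R U) (h : PP 𝒞 k (R ∪ {u})) :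
    PP 𝒞 k (R ∪ {v}) := by
  refine PP.pull (fun y => if y = v then u else y) k _ _ ?_ ?_ h
  · grind
  · intro A hA
    rw [Finset.disjoint_left] at hR
    rcases hU A hA with h1 | h1 | h1
    · left; grind
    · right; exact ⟨A, hA, by grind⟩
    · right; exact ⟨A, hA, by grind⟩

/-- glue -/
lemma PP.glue {𝒞 : Set (Finset α)} {B : Finset α} (hB : ∀ A ∈ 𝒞, ∀ A' ∈ 𝒞, Cpt B A A') :
    ∀ (k : ℕ) (D : Finset α), Disjoint B D →
    (∀ A ∈ 𝒞, (∀ x ∈ D, x ∉ A) ∨ (∀ x ∈ B, x ∉ A) ∨ (∀ x ∈ D ∪ B, x ∈ A)) →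
    PP 𝒞 k D → PP 𝒞 k (D ∪ B) := by
  intro k
  induction k with
  | zero =>
    intro D hD h hP A hA A' hA'
    have h1 := hB A hA A' hA'
    have h2 := hP A hA A' hA'
    have h3 := h A hA
    have h4 := h A' hA'
    exact cpt_glue0 h1 h2 h3 h4
  | succ k ih =>
    rintro D hD h ⟨S, hS, h1, h2, h3⟩
    refine ⟨S, by grind, ?_, h2, ?_⟩
    · intro A hA
      have h4 := h A hA
      have h5 := h1 A hA
      rw [Finset.disjoint_left] at hD
      exact cpt_glue1 hS hD h4 h5
    · have := ih (D \ S) (by rw [Finset.disjoint_left] at *; grind) (fun A hA => by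
        rcases h A hA with h4 | h4 | h4
        · left; grind
        · right; left; exact h4
        · right; right; grind) h3
      refine this.subset ?_
      grind

lemma PP.split {𝒞 : Set (Finset α)} : ∀ (k : ℕ) (X U : Finset α) (u : α), u ∈ U → U ⊆ X →
    (∀ A ∈ 𝒞, Cpt X A U) → PP 𝒞 k X →
    ∃ a b, a + b ≤ k ∧ PP 𝒞 a U ∧ PP 𝒞 b (X \ U ∪ {u}) := by
  intro k
  induction k with
  | zero =>
    intro X U u hu hUX hU hP
    exact ⟨0, 0, le_rfl, hP.subset hUX, hP.subset (by grind)⟩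
  | succ k ih =>
    rintro X U u hu hUX hU ⟨S, hS, h1, h2, h3⟩
    have hXU : X \ U ∪ U = X := by grind
    by_cases c1 : U ⊆ S
    · refine ⟨0, k+1, by omega, fun A hA B hB => (h2 A hA B hB).mono c1, ?_⟩
      exact PP.subset (X := X) ⟨S, hS, h1, h2, h3⟩ (by grind)
    obtain ⟨v, hvU, hvS⟩ := Finset.not_subset.1 c1
    obtain ⟨a, b, hab, ha, hb⟩ := ih (X \ S) (U \ S) v (by grind) (by grind) (by
      intro A hA
      exact cpt_sdiff S (hU A hA)) h3
    by_cases c2 : S ⊆ U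
    · refine ⟨a+1, b, by omega, ⟨S, c2, fun A hA => (h1 A hA).mono hUX, h2, ha⟩, ?_⟩
      refine PP.change (U := U) hvU hu (by rwa [hXU]) Finset.sdiff_disjoint ?_
      exact hb.subset (by grind)
    · obtain ⟨s, hsS, hsU⟩ := Finset.not_subset.1 c2
      refine ⟨a, b+1, by omega, ?_, ?_⟩
      · have : U = (U \ S) ∪ (U ∩ S) := by grind
        rw [this]
        refine PP.glue ?_ a _ ?_ ?_ ha
        · intro A hA A' hA'; exact (h2 A hA A' hA').mono (by grind)
        · rw [Finset.disjoint_left]; grind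
        · intro A hA
          have h4 := hU A hA
          have h5 := h1 A hA
          exact cpt_split1 hS hUX hsS hsU h4 h5
      · refine PP.change (U := U) hvU hu (by rwa [hXU]) Finset.sdiff_disjoint ?_
        refine ⟨S \ U, by grind, ?_, ?_, hb.subset (by grind)⟩
        · intro A hA
          have h4 := hU A hA
          have h5 := h1 A hA
          exact cpt_split2 hS hUX hvU hvS h4 h5
        · intro A hA A' hA'; exact (h2 A hA A' hA').mono (by grind)

lemma PP.blow {𝒞 : Set (Finset α)} {U : Finset α} {u : α} (hu : u ∈ U)
    (hB : ∀ A ∈ 𝒞, ∀ A' ∈ 𝒞, Cpt U A A') :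
    ∀ (k : ℕ) (R : Finset α), Disjoint R U → (∀ A ∈ 𝒞, Cpt (R ∪ U) A U) →
    PP 𝒞 k (R ∪ {u}) → PP 𝒞 k (R ∪ U) := by
  intro k
  induction k with
  | zero =>
    intro R hR hU hP A hA A' hA'
    have h1 := hB A hA A' hA'
    have h2 := hP A hA A' hA'
    have h3 := hU A hA
    have h4 := hU A' hA'
    rw [Finset.disjoint_left] at hR
    exact cpt_blow0 hu hR h1 h2 h3 h4
  | succ k ih =>
    rintro R hR hU ⟨S, hS, h1, h2, h3⟩
    have hR' := hR
    rw [Finset.disjoint_left] at hR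
    by_cases hs : u ∈ S
    · refine ⟨S ∪ U, ?_, ?_, ?_, h3.subset ?_⟩
      · grind
      · intro A hA
        have h4 := hU A hA
        have h5 := h1 A hA
        exact cpt_blow1 hu hR hs h5 h4
      · intro A hA A' hA'
        have hSu : S ∪ U = (S \ {u}) ∪ U := by grind
        have hSu2 : S \ {u} ∪ {u} = S := by grind
        rw [hSu]
        refine cpt_blow0 hu (by grind) (hB A hA A' hA') ?_ ((hU A hA).mono (by grind))
          ((hU A' hA').mono (by grind))
        rw [hSu2]
        exact h2 A hA A' hA'
      · grind
    · refine ⟨S, by grind, ?_, h2, ?_⟩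
      · intro A hA
        have h4 := hU A hA
        have h5 := h1 A hA
        exact cpt_blow2 hu hR hs hS h5 h4
      · refine (ih (R \ S) ?_ ?_ (h3.subset ?_)).subset ?_
        · rw [Finset.disjoint_left]; grind
        · intro A hA; exact (hU A hA).mono (by grind)
        · grind
        · grind

lemma PP.join {𝒞 : Set (Finset α)} : ∀ (a b : ℕ) (X U : Finset α) (u : α), u ∈ U → U ⊆ X →
    (∀ A ∈ 𝒞, Cpt X A U) → PP 𝒞 a U → PP 𝒞 b (X \ U ∪ {u}) → PP 𝒞 (a + b) X := by
  intro a
  induction a with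
  | zero =>
    intro b X U u hu hUX hU ha hb
    have hXU : X \ U ∪ U = X := by grind
    have := PP.blow hu ha b (X \ U) Finset.sdiff_disjoint (by rwa [hXU]) hb
    rw [hXU] at this
    simpa using this
  | succ a ih =>
    rintro b X U u hu hUX hU ⟨S, hS, h1, h2, h3⟩ hb
    have hXU : X \ U ∪ U = X := by grind
    by_cases c : U ⊆ S
    · have := PP.blow hu (fun A hA A' hA' => (h2 A hA A' hA').mono c) b (X \ U)
        Finset.sdiff_disjoint (by rwa [hXU]) hb
      rw [hXU] at this
      exact this.mono (by omega)
    · obtain ⟨v, hvU, hvS⟩ := Finset.not_subset.1 c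
      have hb' := PP.change (U := U) hu hvU (by rwa [hXU]) Finset.sdiff_disjoint hb
      have := ih b (X \ S) (U \ S) v (by grind) (by grind) (by
        intro A hA
        exact cpt_sdiff S (hU A hA)) h3 (hb'.subset (by grind))
      have h : PP 𝒞 (a + b + 1) X := by
        refine ⟨S, by grind, ?_, h2, this⟩
        intro A hA
        have h4 := hU A hA
        have h5 := h1 A hA
        exact cpt_join hUX hS hvU hvS h4 h5
      exact h.mono (by omega)


def Up {V : Type*} (s : V → V) (a b : V) : Prop := ∃ n : ℕ, s^[n] a = b

section
variable {V : Type*} {s : V → V} {a b c : V}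

lemma Up.refl (s : V → V) (a : V) : Up s a a := ⟨0, rfl⟩

lemma Up.trans (h : Up s a b) (h' : Up s b c) : Up s a c := by
  obtain ⟨n, rfl⟩ := h
  obtain ⟨m, rfl⟩ := h'
  exact ⟨m + n, Function.iterate_add_apply s m n a⟩

lemma Up.step (s : V → V) (a : V) : Up s a (s a) := ⟨1, rfl⟩

lemma Up.chain (h : Up s a b) (h' : Up s a c) : Up s b c ∨ Up s c b := by
  obtain ⟨n, rfl⟩ := h
  obtain ⟨m, rfl⟩ := h'
  rcases le_total n m with h | h
  · left; refine ⟨m - n, ?_⟩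
    rw [← Function.iterate_add_apply, Nat.sub_add_cancel h]
  · right; refine ⟨n - m, ?_⟩
    rw [← Function.iterate_add_apply, Nat.sub_add_cancel h]

lemma Up.cases (h : Up s a b) : a = b ∨ Up s (s a) b := by
  obtain ⟨n, rfl⟩ := h
  cases n with
  | zero => left; rfl
  | succ n => right; exact ⟨n, rfl⟩

lemma Up.rk {ρ : V} {rk : V → ℕ} (h0 : s ρ = ρ) (h1 : ∀ v, v ≠ ρ → rk (s v) < rk v)
    (h : Up s a b) : a = b ∨ rk b < rk a := by
  obtain ⟨n, rfl⟩ := h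
  induction n generalizing a with
  | zero => left; rfl
  | succ n ih =>
    rw [Function.iterate_succ_apply]
    by_cases ha : a = ρ
    · subst ha
      rw [h0]
      exact ih
    · right
      rcases @ih (s a) with h | h
      · rw [← h]; exact h1 a ha
      · exact h.trans (h1 a ha)

lemma Up.fixed {ρ : V} (h0 : s ρ = ρ) (h : Up s ρ b) : b = ρ := by
  obtain ⟨n, rfl⟩ := h
  exact Function.iterate_fixed h0 n

lemma Up.root {ρ : V} {rk : V → ℕ} (h1 : ∀ v, v ≠ ρ → rk (s v) < rk v) : ∀ a, Up s a ρ := by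
  intro a
  induction h : rk a using Nat.strong_induction_on generalizing a with
  | _ n ih =>
    by_cases ha : a = ρ
    · subst ha; exact Up.refl _ _
    · subst h
      exact (Up.step s a).trans (ih _ (h1 a ha) _ rfl)

lemma chain_cpt {X A B : Finset α} {ℓ : α → V} {w w' : V}
    (hA : ∀ x ∈ X, x ∈ A ↔ Up s (ℓ x) w) (hB : ∀ x ∈ X, x ∈ B ↔ Up s (ℓ x) w') :
    Cpt X A B := by
  by_cases h1 : Up s w w'
  · left; intro x hx h; exact (hB x hx).2 (((hA x hx).1 h).trans h1)
  by_cases h2 : Up s w' w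
  · right; left; intro x hx h; exact (hA x hx).2 (((hB x hx).1 h).trans h2)
  · right; right; intro x hx h h'
    rcases ((hA x hx).1 h).chain ((hB x hx).1 h') with h | h
    · exact h1 h
    · exact h2 h

lemma Up.agree {s' : V → V} {ρ : V} {rk : V → ℕ} (h0 : s ρ = ρ)
    (h1 : ∀ v, v ≠ ρ → rk (s v) < rk v) (m : ℕ)
    (hag : ∀ z, m < rk z → s z = s' z) (hb : m ≤ rk b) (h : Up s a b) : Up s' a b := by
  obtain ⟨n, hn⟩ := h
  induction n generalizing a with
  | zero => exact ⟨0, hn⟩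
  | succ n ih =>
    by_cases hab : a = b
    · subst hab; exact Up.refl _ _
    have ha : a ≠ ρ := by
      rintro rfl
      exact hab (Up.fixed h0 ⟨_, hn⟩).symm
    have h2 := h1 a ha
    rw [Function.iterate_succ_apply] at hn
    have h3 : m < rk a := by
      rcases Up.rk h0 h1 ⟨n, hn⟩ with h | h
      · rw [h] at h2; omega
      · omega
    have := ih hn
    rw [hag a h3] at this
    exact (Up.step s' a).trans this

lemma Up.avoid {s' : V → V} {v : V} (hv : ¬ Up s a v) (hag : ∀ z, z ≠ v → s z = s' z) :
    Up s a b ↔ Up s' a b := by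
  have : ∀ n, s^[n] a = s'^[n] a := by
    intro n
    induction n with
    | zero => rfl
    | succ n ih =>
      rw [Function.iterate_succ_apply', Function.iterate_succ_apply', ← ih]
      exact hag _ (fun h => hv ⟨n, h⟩)
  unfold Up
  simp [this]
end

lemma genNet_PP {V : Type} [Fintype V] (ρ : V) (rk : V → ℕ) (𝒞 : Set (Finset α)) (ℓ : α → V) :
    ∀ (r : ℕ) (pa : V → Finset V) (X : Finset α),
      (∀ v, (pa v).Nonempty) → pa ρ = {ρ} → (∀ v, v ≠ ρ → ∀ a ∈ pa v, rk a < rk v) →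
      ∑ v, ((pa v).card - 1) = r →
      (∀ A ∈ 𝒞, ∃ σ : V → V, (∀ v, σ v ∈ pa v) ∧ ∃ w, ∀ x ∈ X, x ∈ A ↔ Up σ (ℓ x) w) →
      PP 𝒞 r X := by
  intro r
  induction r with
  | zero =>
    intro pa X hne hρ hrk hsum hrep A hA B hB
    obtain ⟨σ, hσ, w, hw⟩ := hrep A hA
    obtain ⟨τ, hτ, w', hw'⟩ := hrep B hB
    have : σ = τ := by
      funext v
      rw [Finset.sum_eq_zero_iff] at hsum
      have := hsum v (Finset.mem_univ _)
      exact Finset.card_le_one.1 (by omega) _ (hσ v) _ (hτ v)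
    subst this
    exact chain_cpt hw hw'
  | succ r ih =>
    intro pa X hne hρ hrk hsum hrep
    have hex : (Finset.univ.filter fun v => 2 ≤ (pa v).card).Nonempty := by
      by_contra h
      rw [Finset.not_nonempty_iff_eq_empty, Finset.filter_eq_empty_iff] at h
      have : ∑ v, ((pa v).card - 1) = 0 := by
        apply Finset.sum_eq_zero
        intro v hv
        have := h hv
        omega
      omega
    obtain ⟨v, hv, hmax⟩ := Finset.exists_max_image _ rk hex
    simp only [Finset.mem_filter, Finset.mem_univ, true_and] at hv hmax
    have hvρ : v ≠ ρ := by rintro rfl; rw [hρ] at hv; simp at hv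
    choose σ0 hσ0 using hne
    have root : ∀ σ : V → V, (∀ v, σ v ∈ pa v) → σ ρ = ρ := by
      intro σ h; have := h ρ; rw [hρ] at this; simpa using this
    have hlt : ∀ σ : V → V, (∀ v, σ v ∈ pa v) → ∀ v, v ≠ ρ → rk (σ v) < rk v :=
      fun σ h v hv => hrk v hv _ (h v)
    have agree : ∀ σ τ : V → V, (∀ v, σ v ∈ pa v) → (∀ v, τ v ∈ pa v) → ∀ y w, rk v ≤ rk w →
        Up σ y w → Up τ y w := by
      intro σ τ hσ hτ y w hw h
      refine Up.agree (root σ hσ) (hlt σ hσ) (rk v) ?_ hw h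
      intro z hz
      have : ¬ 2 ≤ (pa z).card := fun h => by have := hmax z h; omega
      exact Finset.card_le_one.1 (by omega) _ (hσ z) _ (hτ z)
    refine ⟨X.filter fun x => Up σ0 (ℓ x) v, Finset.filter_subset _ _, ?_, ?_, ?_⟩
    · intro A hA
      obtain ⟨σ, hσ, w, hw⟩ := hrep A hA
      refine chain_cpt hw (w' := v) ?_
      intro x hx
      simp only [Finset.mem_filter, hx, true_and]
      exact ⟨agree _ _ hσ0 hσ _ _ le_rfl, agree _ _ hσ hσ0 _ _ le_rfl⟩
    · have key : ∀ A ∈ 𝒞, (∀ x ∈ X.filter (fun x => Up σ0 (ℓ x) v), x ∈ A) ∨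
          (∀ x ∈ X.filter (fun x => Up σ0 (ℓ x) v), x ∉ A) ∨
          ∃ w, ∀ x ∈ X.filter (fun x => Up σ0 (ℓ x) v), x ∈ A ↔ Up σ0 (ℓ x) w := by
        intro A hA
        obtain ⟨σ, hσ, w, hw⟩ := hrep A hA
        by_cases h1 : Up σ v w
        · left; intro x hx
          simp only [Finset.mem_filter] at hx
          exact (hw x hx.1).2 ((agree _ _ hσ0 hσ _ _ le_rfl hx.2).trans h1)
        by_cases h2 : Up σ w v
        · right; right; refine ⟨w, ?_⟩
          have h3 : rk v ≤ rk w := by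
            rcases Up.rk (root σ hσ) (hlt σ hσ) h2 with h | h
            · rw [h]
            · omega
          intro x hx
          simp only [Finset.mem_filter] at hx
          rw [hw x hx.1]
          exact ⟨agree _ _ hσ hσ0 _ _ h3, agree _ _ hσ0 hσ _ _ h3⟩
        · right; left; intro x hx hxA
          simp only [Finset.mem_filter] at hx
          rcases ((hw x hx.1).1 hxA).chain (agree _ _ hσ0 hσ _ _ le_rfl hx.2) with h | h
          · exact h2 h
          · exact h1 h
      intro A hA B hB
      rcases key A hA with h | h | ⟨w, h⟩
      · right; left; intro x hx _; exact h x hx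
      · left; intro x hx h'; exact absurd h' (h x hx)
      rcases key B hB with h' | h' | ⟨w', h'⟩
      · left; intro x hx _; exact h' x hx
      · right; left; intro x hx h''; exact absurd h'' (h' x hx)
      exact chain_cpt h h'
    · obtain ⟨a, ha⟩ : (pa v).Nonempty := ⟨_, hσ0 v⟩
      obtain ⟨a', ha'⟩ : ((pa v).erase a).Nonempty := by
        rw [← Finset.card_pos, Finset.card_erase_of_mem ha]; omega
      refine ih (Function.update pa v ((pa v).erase a)) _ ?_ ?_ ?_ ?_ ?_
      · intro z
        by_cases hz : z = v
        · subst hz; simp only [Function.update_self]; exact ⟨a', ha'⟩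
        · rw [Function.update_of_ne hz]; exact ⟨_, hσ0 z⟩
      · rw [Function.update_of_ne hvρ.symm]; exact hρ
      · intro z hz b hb
        by_cases hzv : z = v
        · subst hzv; simp only [Function.update_self] at hb
          exact hrk z hz b (Finset.mem_of_mem_erase hb)
        · rw [Function.update_of_ne hzv] at hb; exact hrk z hz b hb
      · rw [← Finset.add_sum_erase _ _ (Finset.mem_univ v)] at hsum ⊢
        simp only [Function.update_self]
        rw [Finset.card_erase_of_mem ha]
        have : ∑ x ∈ Finset.univ.erase v,
            ((Function.update pa v ((pa v).erase a) x).card - 1) =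
            ∑ x ∈ Finset.univ.erase v, ((pa x).card - 1) := by
          apply Finset.sum_congr rfl
          intro x hx
          rw [Function.update_of_ne (Finset.ne_of_mem_erase hx)]
        rw [this]; omega
      · intro A hA
        obtain ⟨σ, hσ, w, hw⟩ := hrep A hA
        refine ⟨Function.update σ v a', ?_, w, ?_⟩
        · intro z
          by_cases hz : z = v
          · subst hz; simpa using ha'
          · rw [Function.update_of_ne hz, Function.update_of_ne hz]; exact hσ z
        · intro x hx
          simp only [Finset.mem_sdiff, Finset.mem_filter, not_and] at hx
          rw [hw x hx.1]
          refine Up.avoid (v := v) ?_ ?_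
          · intro h; exact hx.2 hx.1 (agree _ _ hσ hσ0 _ _ le_rfl h)
          · intro z hz; rw [Function.update_of_ne hz]


def Acyc (N : Net α) : Prop := ∀ v : Fin N.n, ¬ Relation.TransGen N.Adj v v

noncomputable def nrk (N : Net α) (v : Fin N.n) : ℕ :=
  (Finset.univ.filter fun a => Relation.TransGen N.Adj a v).card

lemma nrk_lt {N : Net α} (h : Acyc N) {a b : Fin N.n} (hab : N.Adj a b) : nrk N a < nrk N b := by
  apply Finset.card_lt_card
  rw [Finset.ssubset_iff_of_subset]
  · exact ⟨a, by simpa using Relation.TransGen.single hab, by simpa using h a⟩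
  · intro x hx
    simp only [Finset.mem_filter, Finset.mem_univ, true_and] at hx ⊢
    exact hx.tail hab

lemma exists_adj_of_indeg {N : Net α} {v : Fin N.n} (h : N.indeg v ≠ 0) : ∃ a, N.Adj a v := by
  unfold Net.indeg at h
  rw [Finset.card_ne_zero] at h
  obtain ⟨⟨a, b⟩, he⟩ := h
  simp only [Finset.mem_filter] at he
  obtain ⟨h1, rfl⟩ := he
  exact ⟨a, h1⟩

lemma indeg_ne_zero {N : Net α} {a v : Fin N.n} (h : N.Adj a v) : N.indeg v ≠ 0 := by
  unfold Net.indeg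
  rw [Finset.card_ne_zero]
  exact ⟨(a, v), by simpa [Net.Adj] using h⟩

lemma root_reaches {N : Net α} (h : Acyc N) {ρ : Fin N.n} (hρ : ∀ v, N.indeg v = 0 → v = ρ) :
    ∀ v, N.Reaches ρ v := by
  intro v
  induction hn : nrk N v using Nat.strong_induction_on generalizing v with
  | _ n ih =>
    by_cases hv : N.indeg v = 0
    · rw [hρ v hv]; exact Relation.ReflTransGen.refl
    · obtain ⟨a, ha⟩ := exists_adj_of_indeg hv
      subst hn
      exact (ih _ (nrk_lt h ha) a rfl).tail ha

noncomputable def inN (N : Net α) (v : Fin N.n) : Finset (Fin N.n) :=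
  if N.indeg v = 0 then {v} else Finset.univ.filter fun a => N.Adj a v

lemma card_inN (N : Net α) (v : Fin N.n) : (inN N v).card - 1 = N.indeg v - 1 := by
  unfold inN
  split_ifs with h
  · simp [h]
  · congr 1
    unfold Net.indeg
    refine Finset.card_bij (fun a _ => (a, v)) ?_ ?_ ?_
    · intro a ha
      simp only [Finset.mem_filter, Finset.mem_univ, true_and] at ha
      simpa [Net.Adj] using ha
    · intro a _ b _ h; simpa using h
    · rintro ⟨a, b⟩ hb
      simp only [Finset.mem_filter] at hb
      obtain ⟨h1, rfl⟩ := hb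
      exact ⟨a, Finset.mem_filter.2 ⟨Finset.mem_univ _, h1⟩, rfl⟩

lemma inN_nonempty (N : Net α) (v : Fin N.n) : (inN N v).Nonempty := by
  unfold inN
  split_ifs with h
  · simp
  · obtain ⟨a, ha⟩ := exists_adj_of_indeg h
    exact ⟨a, by simpa using ha⟩

lemma tree_parent_unique {T : Net α} (hT : T.reticNum = 0) {a b v : Fin T.n} (ha : T.Adj a v)
    (hb : T.Adj b v) : a = b := by
  unfold Net.reticNum at hT
  rw [Finset.sum_eq_zero_iff] at hT
  have h1 := hT v (Finset.mem_univ _)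
  unfold Net.indeg at h1
  have h2 : (T.E.filter fun e => e.2 = v).card ≤ 1 := by omega
  have : ((a, v) : Fin T.n × Fin T.n) = (b, v) :=
    Finset.card_le_one.1 h2 _ (by simpa [Net.Adj] using ha) _ (by simpa [Net.Adj] using hb)
  exact (Prod.ext_iff.1 this).1

lemma path_nodup {N : Net α} (h : Acyc N) {p : List (Fin N.n)} (hp : p.Chain' N.Adj) :
    p.Nodup := by
  have h1 : p.Chain' (Relation.TransGen N.Adj) := hp.imp fun a b hab => Relation.TransGen.single hab
  have h2 := List.isChain_iff_pairwise.1 h1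
  refine h2.imp ?_
  rintro a b hab rfl
  exact h a hab

lemma mem_internals {β : Type*} {p : List β} {i : ℕ} (hi : i + 2 < p.length) :
    p[i+1] ∈ internals p := by
  unfold internals
  rw [List.mem_iff_getElem]
  refine ⟨i, by simp; omega, ?_⟩
  simp

lemma displays_switch {X : Finset α} {N T : Net α} (hN : IsPhyloNet X N) (hT : IsPhyloTree X T)
    (hD : Displays N T) : ∃ (σ : Fin N.n → Fin N.n) (φ : Fin T.n → Fin N.n),
      (∀ v, σ v ∈ inN N v) ∧ (∀ v, T.IsLeaf v → N.IsLeaf (φ v) ∧ N.label (φ v) = T.label v) ∧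
      ∀ y z, T.Reaches y z ↔ Up σ (φ z) (φ y) := by
  obtain ⟨φ, hφ, hleaf, P, hP, hP1, hP2⟩ := hD
  have hac : Acyc N := hN.1
  have hnd : ∀ e ∈ T.E, (P e).Nodup := fun e he => path_nodup hac (hP e he).2.2.1
  let F : Fin N.n → Fin N.n → Prop := fun a b =>
    ∃ e ∈ T.E, ∃ (i : ℕ) (hi : i + 1 < (P e).length), (P e)[i] = a ∧ (P e)[i+1] = b
  have hFadj : ∀ a b, F a b → N.Adj a b := by
    rintro a b ⟨e, he, i, hi, rfl, rfl⟩
    have := (hP e he).2.2.1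
    exact List.isChain_iff_getElem.1 this i hi
  have hlast : ∀ e ∈ T.E, ∀ i (hi : i < (P e).length), i + 1 = (P e).length → (P e)[i] = φ e.2 := by
    intro e he i hi h
    have := (hP e he).2.1
    rw [List.getLast?_eq_getElem?] at this
    have h2 : (P e).length - 1 = i := by omega
    rw [h2, List.getElem?_eq_getElem hi] at this
    simpa using this
  have hhead : ∀ e ∈ T.E, ∀ (hi : 0 < (P e).length), (P e)[0] = φ e.1 := by
    intro e he hi
    have := (hP e he).1
    rw [List.head?_eq_getElem?, List.getElem?_eq_getElem hi] at this
    simpa using this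
  have hFuniq : ∀ a a' b, F a b → F a' b → a = a' := by
    rintro a a' b ⟨e, he, i, hi, rfl, rfl⟩ ⟨f, hf, j, hj, rfl, hb⟩
    have hef : e = f := by
      by_cases h1 : i + 2 < (P e).length
      · have m1 := mem_internals h1
        by_cases h2 : j + 2 < (P f).length
        · have m2 := mem_internals h2
          by_contra hne
          rw [hb] at m2
          exact hP2 e he f hf hne _ m1 m2
        · have := hlast f hf (j+1) hj (by omega)
          rw [hb] at this
          exact absurd ⟨_, this.symm⟩ (hP1 e he _ m1)
      · have l1 := hlast e he (i+1) hi (by omega)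
        by_cases h2 : j + 2 < (P f).length
        · have m2 := mem_internals h2
          rw [hb] at m2
          exact absurd ⟨_, l1.symm⟩ (hP1 f hf _ m2)
        · have l2 := hlast f hf (j+1) hj (by omega)
          have h3 : e.2 = f.2 := hφ (by rw [← l1, ← l2, hb])
          have h4 : T.Adj e.1 e.2 := he
          have h5 : T.Adj f.1 e.2 := by rw [h3]; exact hf
          exact Prod.ext (tree_parent_unique hT.2 h4 h5) h3
    subst hef
    have := (List.Nodup.getElem_inj_iff (hnd e he)).1 hb
    have : i = j := by omega
    subst this
    rfl
  have hσ : ∀ v, ∃ a, a ∈ inN N v ∧ ∀ b, F b v → a = b := by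
    intro v
    by_cases h : ∃ a, F a v
    · obtain ⟨a, ha⟩ := h
      refine ⟨a, ?_, fun b hb => hFuniq _ _ _ ha hb⟩
      have := hFadj _ _ ha
      unfold inN
      rw [if_neg (indeg_ne_zero this)]
      simpa using this
    · obtain ⟨a, ha⟩ := inN_nonempty N v
      exact ⟨a, ha, fun b hb => absurd ⟨b, hb⟩ h⟩
  choose σ hσ1 hσ2 using hσ
  have hpath : ∀ e (he : e ∈ T.E) (j : ℕ) (hj : j < (P e).length),
      σ^[j] (φ e.2) = (P e)[(P e).length - 1 - j] := by
    intro e he j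
    induction j with
    | zero =>
      intro hj
      exact (hlast e he ((P e).length - 1 - 0) (by omega) (by omega)).symm
    | succ j ih =>
      intro hj
      rw [Function.iterate_succ_apply', ih (by omega)]
      apply hσ2
      refine ⟨e, he, (P e).length - 1 - (j+1), by omega, rfl, ?_⟩
      congr 1
      omega
  have hstep : ∀ a b, T.Adj a b → ∃ m, 1 ≤ m ∧ σ^[m] (φ b) = φ a ∧
      ∀ j, 0 < j → j < m → σ^[j] (φ b) ∉ Set.range φ := by
    intro a b hab
    have hl := (hP (a, b) hab).2.2.2
    refine ⟨(P (a, b)).length - 1, by omega, ?_, ?_⟩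
    · have := hpath (a, b) hab ((P (a, b)).length - 1) (by omega)
      simp only [Nat.sub_self] at this
      rw [this]
      exact hhead (a, b) hab (by omega)
    · intro j hj hjm
      have := hpath (a, b) hab j (by omega)
      simp only at this
      rw [this]
      apply hP1 (a, b) hab
      have h3 := mem_internals (p := P (a, b)) (i := (P (a, b)).length - 1 - j - 1) (by omega)
      have h4 : (P (a, b)).length - 1 - j - 1 + 1 = (P (a, b)).length - 1 - j := by omega
      simpa only [h4] using h3
  have hfwd : ∀ y z, T.Reaches y z → Up σ (φ z) (φ y) := by
    intro y z h
    induction h with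
    | refl => exact Up.refl _ _
    | tail _ h2 ih =>
      obtain ⟨m, _, hm, _⟩ := hstep _ _ h2
      exact Up.trans ⟨m, hm⟩ ih
  obtain ⟨ρ, hρ, hρ'⟩ := hN.2.1
  obtain ⟨r, hr, hr'⟩ := hT.1.2.1
  have hrk : ∀ v, v ≠ ρ → nrk N (σ v) < nrk N v := by
    intro v hv
    have := hσ1 v
    unfold inN at this
    rw [if_neg (fun h => hv (hρ' v h))] at this
    simp only [Finset.mem_filter, Finset.mem_univ, true_and] at this
    exact nrk_lt hac this
  have hσρ : σ ρ = ρ := by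
    have := hσ1 ρ
    unfold inN at this
    rw [if_pos hρ] at this
    simpa using this
  refine ⟨σ, φ, hσ1, hleaf, fun y z => ⟨hfwd y z, ?_⟩⟩
  rintro ⟨n, hn⟩
  induction n using Nat.strong_induction_on generalizing z with
  | _ n ih =>
    by_cases hz : T.indeg z = 0
    · have h1 := root_reaches hT.1.1 hr' y
      rw [← hr' z hz] at h1
      have h2 := hfwd _ _ h1
      have : φ z = φ y := by
        rcases Up.rk hσρ hrk ⟨n, hn⟩ with h | h
        · exact h
        · rcases Up.rk hσρ hrk h2 with h' | h'
          · exact h'.symm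
          · omega
      rw [hφ this]
      exact Relation.ReflTransGen.refl
    · obtain ⟨p, hp⟩ := exists_adj_of_indeg hz
      obtain ⟨m, hm1, hm2, hm3⟩ := hstep _ _ hp
      rcases Nat.eq_zero_or_pos n with h0 | h0
      · subst h0
        rw [hφ hn]
        exact Relation.ReflTransGen.refl
      by_cases hnm : n < m
      · exact absurd ⟨y, hn.symm⟩ (hm3 n h0 hnm)
      · have : σ^[n - m] (φ p) = φ y := by
          rw [← hm2, ← Function.iterate_add_apply, Nat.sub_add_cancel (by omega), hn]
        exact (ih (n - m) (by omega) p this).tail hp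

/-- label-inverse -/
lemma exists_leafmap {X : Finset α} {N : Net α} (hN : IsPhyloNet X N) :
    ∃ ℓ : α → Fin N.n, ∀ x ∈ X, N.IsLeaf (ℓ x) ∧ N.label (ℓ x) = x ∧
      ∀ v, N.IsLeaf v → N.label v = x → v = ℓ x := by
  obtain ⟨ρ, _⟩ := hN.2.1
  have h := hN.2.2.2.2
  have : ∀ x : α, ∃ v, x ∈ X → N.IsLeaf v ∧ N.label v = x ∧
      ∀ w, N.IsLeaf w → N.label w = x → w = v := by
    intro x
    by_cases hx : x ∈ X
    · obtain ⟨v, hv, hvx⟩ := h.2.2 hx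
      refine ⟨v, fun _ => ⟨hv, hvx, fun w hw hwx => h.2.1 hw hv (hwx.trans hvx.symm)⟩⟩
    · exact ⟨ρ, fun h => absurd h hx⟩
  choose ℓ hℓ using this
  exact ⟨ℓ, fun x hx => hℓ x hx⟩

lemma mem_clusterBelow {X : Finset α} {T : Net α} (hT : IsPhyloNet X T) {ℓ : α → Fin T.n}
    (hℓ : ∀ x ∈ X, T.IsLeaf (ℓ x) ∧ T.label (ℓ x) = x ∧
      ∀ v, T.IsLeaf v → T.label v = x → v = ℓ x) (v : Fin T.n) (x : α) :
    x ∈ T.clusterBelow v ↔ x ∈ X ∧ T.Reaches v (ℓ x) := by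
  unfold Net.clusterBelow
  simp only [Finset.mem_image, Finset.mem_filter, Finset.mem_univ, true_and]
  constructor
  · rintro ⟨w, ⟨h1, h2⟩, rfl⟩
    have hx : T.label w ∈ X := hT.2.2.2.2.1 h2
    refine ⟨hx, ?_⟩
    rw [← (hℓ _ hx).2.2 w h2 rfl]; exact h1
  · rintro ⟨hx, h⟩
    exact ⟨ℓ x, ⟨h, (hℓ x hx).1⟩, (hℓ x hx).2.1⟩

theorem PP_of_net {X : Finset α} {N : Net α} {𝒞 : Set (Finset α)} (hN : IsPhyloNet X N)
    (hR : RepresentsSet X N 𝒞) : PP 𝒞 N.reticNum X := by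
  obtain ⟨ρ, hρ, hρ'⟩ := hN.2.1
  obtain ⟨ℓ, hℓ⟩ := exists_leafmap hN
  refine genNet_PP ρ (nrk N) 𝒞 ℓ _ (inN N) X (inN_nonempty N) ?_ ?_ ?_ ?_
  · unfold inN; rw [if_pos hρ]
  · intro v hv a ha
    unfold inN at ha
    rw [if_neg (fun h => hv (hρ' v h))] at ha
    simp only [Finset.mem_filter, Finset.mem_univ, true_and] at ha
    exact nrk_lt hN.1 ha
  · unfold Net.reticNum
    exact Finset.sum_congr rfl fun v _ => card_inN N v
  · intro A hA
    obtain ⟨T, hT, hD, e, he, rfl⟩ := hR A hA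
    obtain ⟨σ, φ, hσ, hφ, hup⟩ := displays_switch hN hT hD
    refine ⟨σ, hσ, φ e.2, ?_⟩
    intro x hx
    obtain ⟨m, hm⟩ := exists_leafmap hT.1
    rw [mem_clusterBelow hT.1 hm]
    simp only [hx, true_and]
    rw [hup]
    have h1 := hm x hx
    have h2 := hφ _ h1.1
    rw [(hℓ x hx).2.2 _ h2.1 (h2.2.trans h1.2.1)]


structure Sw {V : Type} (ρ : V) (rk : V → ℕ) (s : V → V) : Prop where
  root : s ρ = ρ
  lt : ∀ v, v ≠ ρ → rk (s v) < rk v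

def Rep {V : Type} (s : V → V) (ℓ : α → V) (X A : Finset α) : Prop :=
  ∃ w, ∀ x ∈ X, x ∈ A ↔ Up s (ℓ x) w

section ext
variable {V W : Type} (ρ : V) (σ : V → V) (ρS : W) (τ : W → W) (a : V)

noncomputable def ext : (V × Bool) ⊕ W → (V × Bool) ⊕ W
  | .inl (v, false) => .inl (v, true)
  | .inl (v, true) => if v = ρ then .inl (ρ, true) else .inl (σ v, false)
  | .inr z => if z = ρS then .inl (a, true) else .inr (τ z)

lemma ext_sw [Fintype V] {rk : V → ℕ} {rkS : W → ℕ} (h1 : Sw ρ rk σ) (h2 : Sw ρS rkS τ) :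
    Sw (V := (V × Bool) ⊕ W) (.inl (ρ, true))
      (fun y => match y with
        | .inl (v, b) => 2 * rk v + (if b then 0 else 1)
        | .inr z => 2 * (∑ v, rk v) + 1 + rkS z) (ext ρ σ ρS τ a) := by
  constructor
  · simp [ext]
  · rintro (⟨v, b⟩ | z) h
    · cases b
      · simp [ext]
      · have hv : v ≠ ρ := by rintro rfl; exact h rfl
        have := h1.lt v hv
        simp [ext, hv]; omega
    · by_cases hz : z = ρS
      · have : rk a ≤ ∑ v, rk v := Finset.single_le_sum (fun _ _ => Nat.zero_le _) (Finset.mem_univ a)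
        simp [ext, hz]; omega
      · have := h2.lt z hz
        simp [ext, hz]; omega

variable {ρ σ ρS τ a}

lemma ext_up_true {y w : V} (h : Up σ y w) (h0 : σ ρ = ρ) :
    Up (ext ρ σ ρS τ a) (.inl (y, true)) (.inl (w, true)) := by
  obtain ⟨n, rfl⟩ := h
  induction n generalizing y with
  | zero => exact Up.refl _ _
  | succ n ih =>
    rw [Function.iterate_succ_apply]
    by_cases hy : y = ρ
    · subst hy; rw [h0]; exact ih
    · refine Up.trans (b := .inl (σ y, true)) ⟨2, ?_⟩ ih
      simp [ext, hy]

lemma ext_up_ft (y : V) : Up (ext ρ σ ρS τ a) (.inl (y, false)) (.inl (y, true)) := ⟨1, rfl⟩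

lemma ext_up_false {y w : V} (h : Up σ y w) (h0 : σ ρ = ρ) :
    Up (ext ρ σ ρS τ a) (.inl (y, false)) (.inl (w, false)) := by
  obtain ⟨n, rfl⟩ := h
  induction n generalizing y with
  | zero => exact Up.refl _ _
  | succ n ih =>
    rw [Function.iterate_succ_apply]
    by_cases hy : y = ρ
    · subst hy; rw [h0]; exact ih
    · refine Up.trans (b := .inl (σ y, false)) ⟨2, ?_⟩ ih
      simp [ext, hy]

lemma ext_iter_inl (h0 : σ ρ = ρ) (n : ℕ) (y : V) (b : Bool) : ∃ v c,
    (ext ρ σ ρS τ a)^[n] (.inl (y, b)) = .inl (v, c) ∧ Up σ y v ∧ (b = true → c = false → 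
      ∃ y', y ≠ ρ ∧ y' = σ y ∧ Up σ y' v) := by
  induction n generalizing y b with
  | zero => exact ⟨y, b, rfl, Up.refl _ _, by grind⟩
  | succ n ih =>
    rw [Function.iterate_succ_apply]
    cases b
    · obtain ⟨v, c, h, h', _⟩ := ih y true
      exact ⟨v, c, h, h', by simp⟩
    · by_cases hy : y = ρ
      · obtain ⟨v, c, h, h', h''⟩ := ih y true
        refine ⟨v, c, ?_, h', h''⟩
        have : ext ρ σ ρS τ a (.inl (y, true)) = .inl (y, true) := by simp [ext, hy]
        rw [this]; exact h
      · obtain ⟨v, c, h, h', h''⟩ := ih (σ y) false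
        refine ⟨v, c, ?_, (Up.step σ y).trans h', fun _ _ => ⟨_, hy, rfl, h'⟩⟩
        have : ext ρ σ ρS τ a (.inl (y, true)) = .inl (σ y, false) := by simp [ext, hy]
        rw [this]; exact h

lemma ext_up_inl (h0 : σ ρ = ρ) {y w : V} {b c : Bool}
    (h : Up (ext ρ σ ρS τ a) (.inl (y, b)) (.inl (w, c))) : Up σ y w := by
  obtain ⟨n, hn⟩ := h
  obtain ⟨v, d, h, h', _⟩ := ext_iter_inl (ρS := ρS) (τ := τ) (a := a) h0 n y b
  rw [hn] at h
  simp only [Sum.inl.injEq, Prod.mk.injEq] at h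
  rw [h.1]; exact h'

lemma ext_up_inl_tf {rk : V → ℕ} (hs : Sw ρ rk σ) {y w : V}
    (h : Up (ext ρ σ ρS τ a) (.inl (y, true)) (.inl (w, false))) : y ≠ w ∧ Up σ y w := by
  refine ⟨?_, ext_up_inl hs.root h⟩
  rintro rfl
  obtain ⟨n, hn⟩ := h
  obtain ⟨v, d, h, h', h''⟩ := ext_iter_inl (ρS := ρS) (τ := τ) (a := a) hs.root n y true
  rw [hn] at h
  simp only [Sum.inl.injEq, Prod.mk.injEq] at h
  obtain ⟨y', hy, rfl, h4⟩ := h'' rfl h.2.symm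
  rw [← h.1] at h4
  have h5 := hs.lt y hy
  rcases Up.rk hs.root hs.lt h4 with h6 | h6
  · rw [h6] at h5; omega
  · omega

lemma ext_up_inl_inr (h0 : σ ρ = ρ) {y : V} {z : W} {b : Bool}
    (h : Up (ext ρ σ ρS τ a) (.inl (y, b)) (.inr z)) : False := by
  obtain ⟨n, hn⟩ := h
  obtain ⟨v, d, h, _⟩ := ext_iter_inl (ρS := ρS) (τ := τ) (a := a) h0 n y b
  rw [hn] at h
  simp at h

lemma ext_up_inr {rk : W → ℕ} (hs : Sw ρS rk τ) {z w : W} (h : Up τ z w) :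
    Up (ext ρ σ ρS τ a) (.inr z) (.inr w) := by
  obtain ⟨n, rfl⟩ := h
  induction n generalizing z with
  | zero => exact Up.refl _ _
  | succ n ih =>
    rw [Function.iterate_succ_apply]
    by_cases hz : z = ρS
    · subst hz; rw [hs.root]; exact ih
    · refine Up.trans (b := .inr (τ z)) ⟨1, ?_⟩ ih
      simp [ext, hz]

lemma ext_up_inr_a {rk : W → ℕ} (hs : Sw ρS rk τ) (z : W) :
    Up (ext ρ σ ρS τ a) (.inr z) (.inl (a, true)) := 
  (ext_up_inr hs (Up.root hs.lt z)).trans ⟨1, by simp [ext]⟩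

lemma ext_up_inr_inr (h0 : σ ρ = ρ) {z w : W}
    (h : Up (ext ρ σ ρS τ a) (.inr z) (.inr w)) : Up τ z w := by
  obtain ⟨n, hn⟩ := h
  induction n generalizing z with
  | zero => exact ⟨0, by simpa using hn⟩
  | succ n ih =>
    rw [Function.iterate_succ_apply] at hn
    by_cases hz : z = ρS
    · subst hz
      have : ext ρ σ z τ a (.inr z) = .inl (a, true) := by simp [ext]
      rw [this] at hn
      exact (ext_up_inl_inr h0 ⟨n, hn⟩).elim
    · have : ext ρ σ ρS τ a (.inr z) = .inr (τ z) := by simp [ext, hz]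
      rw [this] at hn
      exact (Up.step τ z).trans (ih hn)

lemma ext_up_inr_inl {rk : W → ℕ} (hs : Sw ρS rk τ) {z : W} {p : V × Bool}
    (h : Up (ext ρ σ ρS τ a) (.inr z) (.inl p)) :
    Up (ext ρ σ ρS τ a) (.inl (a, true)) (.inl p) := by
  obtain ⟨n, hn⟩ := h
  induction n generalizing z with
  | zero => simp at hn
  | succ n ih =>
    rw [Function.iterate_succ_apply] at hn
    by_cases hz : z = ρS
    · subst hz
      have : ext ρ σ z τ a (.inr z) = .inl (a, true) := by simp [ext]
      rw [this] at hn
      exact ⟨n, hn⟩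
    · have : ext ρ σ ρS τ a (.inr z) = .inr (τ z) := by simp [ext, hz]
      rw [this] at hn
      exact ih hn

end ext

lemma attach {V W : Type} {ρ : V} {σ : V → V} {rk : V → ℕ} {ρS : W} {τ : W → W} {rkS : W → ℕ}
    (hσ : Sw ρ rk σ) (hτ : Sw ρS rkS τ) (ℓ : α → V) (ℓS : α → W) (C : Set (Finset α))
    (X' S : Finset α) (hd : ∀ x ∈ X', x ∉ S) (hS : S.Nonempty)
    (hlam : ∀ A ∈ C, ∀ B ∈ C, Cpt (X' ∪ S) A B) (hCS : ∀ A ∈ C, Cpt (X' ∪ S) A S)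
    (r1 : ∀ A ∈ C, (∃ x ∈ X', x ∈ A) → Rep σ ℓ X' A)
    (r2 : ∀ A ∈ C, (∃ x ∈ S, x ∈ A) → Rep τ ℓS S A) :
    ∃ a : V, ∀ A ∈ C, (∃ x ∈ X' ∪ S, x ∈ A) →
      Rep (ext ρ σ ρS τ a) (fun x => if x ∈ S then .inr (ℓS x) else .inl (ℓ x, false)) (X' ∪ S) A := by
  obtain ⟨s0, hs0⟩ := hS
  have : ∀ D : Finset α, ∃ w, Rep σ ℓ X' D → ∀ x ∈ X', x ∈ D ↔ Up σ (ℓ x) w := by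
    intro D
    by_cases h : Rep σ ℓ X' D
    · obtain ⟨w, hw⟩ := h; exact ⟨w, fun _ => hw⟩
    · exact ⟨ρ, fun h' => absurd h' h⟩
  choose w0 hw0 using this
  let w : Finset α → V := fun A => w0 (A ∩ X')
  have hw : ∀ A ∈ C, (∃ x ∈ X', x ∈ A) → ∀ x ∈ X', x ∈ A ↔ Up σ (ℓ x) (w A) := by
    intro A hA hx
    have h1 : Rep σ ℓ X' (A ∩ X') := by
      obtain ⟨u, hu⟩ := r1 A hA hx
      refine ⟨u, fun x hx => ?_⟩
      rw [← hu x hx]; simp [hx]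
    intro x hx
    rw [← hw0 _ h1 x hx]
    simp [hx]
  have hweq : ∀ A B : Finset α, (∀ x ∈ X', x ∈ A ↔ x ∈ B) → w A = w B := by
    intro A B h
    have : A ∩ X' = B ∩ X' := by
      ext x; simp only [Finset.mem_inter]
      constructor
      · rintro ⟨h1, h2⟩; exact ⟨(h x h2).1 h1, h2⟩
      · rintro ⟨h1, h2⟩; exact ⟨(h x h2).2 h1, h2⟩
    simp only [w, this]
  -- the choice of the attachment point
  have ha : ∃ a : V,
      (∀ A ∈ C, (∃ x ∈ X', x ∈ A) → (∀ x ∈ S, x ∈ A) → Up σ a (w A)) ∧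
      (∀ A ∈ C, (∃ x ∈ X', x ∈ A) → (∀ x ∈ S, x ∉ A) → ¬ (a ≠ w A ∧ Up σ a (w A))) := by
    by_cases hex : ∃ A ∈ C, (∃ x ∈ X', x ∈ A) ∧ (∀ x ∈ S, x ∈ A)
    · have hex' : ∃ n, ∃ A ∈ C, (∃ x ∈ X', x ∈ A) ∧ (∀ x ∈ S, x ∈ A) ∧ (A ∩ X').card = n := by
        obtain ⟨A, h1, h2, h3⟩ := hex; exact ⟨_, A, h1, h2, h3, rfl⟩
      obtain ⟨C0, hC0, hC0x, hC0S, hcard⟩ := Nat.find_spec hex'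
      have hmin : ∀ A ∈ C, (∃ x ∈ X', x ∈ A) → (∀ x ∈ S, x ∈ A) →
          (C0 ∩ X').card ≤ (A ∩ X').card := by
        intro A h1 h2 h3
        rw [hcard]
        exact Nat.find_min' hex' ⟨A, h1, h2, h3, rfl⟩
      obtain ⟨x0, hx0, hx0C⟩ := hC0x
      refine ⟨w C0, ?_, ?_⟩
      · intro A hA hAx hAS
        have hsub : ∀ x ∈ X', x ∈ C0 → x ∈ A := by
          rcases hlam C0 hC0 A hA with h | h | h
          · intro x hx; exact h x (by simp [hx])
          · have hsub' : A ∩ X' ⊆ C0 ∩ X' := by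
              intro x hx
              simp only [Finset.mem_inter] at hx ⊢
              exact ⟨h x (by simp [hx.2]) hx.1, hx.2⟩
            have heq := Finset.eq_of_subset_of_card_le hsub' (hmin A hA hAx hAS)
            intro x hx hxC
            have : x ∈ A ∩ X' := by rw [heq]; simp [hx, hxC]
            simp only [Finset.mem_inter] at this
            exact this.1
          · exact absurd (hAS s0 hs0) (h s0 (by simp [hs0]) (hC0S s0 hs0))
        have u1 := (hw C0 hC0 ⟨x0, hx0, hx0C⟩ x0 hx0).1 hx0C
        have u2 := (hw A hA hAx x0 hx0).1 (hsub x0 hx0 hx0C)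
        rcases u1.chain u2 with h | h
        · exact h
        · rw [hweq C0 A]
          · exact Up.refl _ _
          · intro x hx
            refine ⟨hsub x hx, fun hxA => ?_⟩
            exact (hw C0 hC0 ⟨x0, hx0, hx0C⟩ x hx).2 (((hw A hA hAx x hx).1 hxA).trans h)
      · rintro A hA hAx hAS ⟨h1, h2⟩
        apply h1
        apply hweq
        have hsub : ∀ x ∈ X', x ∈ C0 → x ∈ A := by
          intro x hx hxC
          exact (hw A hA hAx x hx).2 (((hw C0 hC0 ⟨x0, hx0, hx0C⟩ x hx).1 hxC).trans h2)
        rcases hlam C0 hC0 A hA with h | h | h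
        · exact absurd (h s0 (by simp [hs0]) (hC0S s0 hs0)) (hAS s0 hs0)
        · intro x hx
          exact ⟨hsub x hx, h x (by simp [hx])⟩
        · exact absurd (hsub x0 hx0 hx0C) (h x0 (by simp [hx0]) hx0C)
    · refine ⟨ρ, ?_, ?_⟩
      · intro A hA h1 h2; exact absurd ⟨A, hA, h1, h2⟩ hex
      · rintro A hA h1 h2 ⟨h3, h4⟩
        exact h3 (Up.fixed hσ.root h4).symm
  obtain ⟨a, ha1, ha2⟩ := ha
  refine ⟨a, ?_⟩
  intro A hA hAne
  have hX'S : ∀ x ∈ X', (if x ∈ S then (.inr (ℓS x) : (V × Bool) ⊕ W) else .inl (ℓ x, false))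
      = .inl (ℓ x, false) := fun x hx => if_neg (hd x hx)
  have hSS : ∀ x ∈ S, (if x ∈ S then (.inr (ℓS x) : (V × Bool) ⊕ W) else .inl (ℓ x, false))
      = .inr (ℓS x) := fun x hx => if_pos hx
  by_cases hAX : ∃ x ∈ X', x ∈ A
  · have hAX' := hAX
    obtain ⟨x1, hx1, hx1A⟩ := hAX
    have hdich : (∀ x ∈ S, x ∈ A) ∨ (∀ x ∈ S, x ∉ A) := by
      rcases hCS A hA with h | h | h
      · exact absurd (h x1 (by simp [hx1]) hx1A) (hd x1 hx1)
      · left; intro x hx; exact h x (by simp [hx]) hx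
      · right; intro x hx h'; exact h x (by simp [hx]) h' hx
    rcases hdich with hAS | hAS
    · refine ⟨.inl (w A, true), ?_⟩
      intro x hx
      rcases Finset.mem_union.1 hx with hx | hx
      · simp only [hX'S x hx]
        rw [hw A hA hAX' x hx]
        exact ⟨fun h => (ext_up_ft _).trans (ext_up_true h hσ.root), ext_up_inl hσ.root⟩
      · simp only [hSS x hx]
        refine ⟨fun _ => (ext_up_inr_a hτ _).trans (ext_up_true (ha1 A hA hAX' hAS) hσ.root),
          fun _ => hAS x hx⟩
    · refine ⟨.inl (w A, false), ?_⟩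
      intro x hx
      rcases Finset.mem_union.1 hx with hx | hx
      · simp only [hX'S x hx]
        rw [hw A hA hAX' x hx]
        exact ⟨fun h => ext_up_false h hσ.root, ext_up_inl hσ.root⟩
      · simp only [hSS x hx]
        refine ⟨fun h => absurd h (hAS x hx), fun h => ?_⟩
        exact absurd (ext_up_inl_tf hσ (ext_up_inr_inl hτ h)) (ha2 A hA hAX' hAS)
  · obtain ⟨u, hu⟩ := r2 A hA (by
      obtain ⟨x, hx, hxA⟩ := hAne
      rcases Finset.mem_union.1 hx with hx | hx
      · exact absurd ⟨x, hx, hxA⟩ hAX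
      · exact ⟨x, hx, hxA⟩)
    refine ⟨.inr u, ?_⟩
    intro x hx
    rcases Finset.mem_union.1 hx with hx | hx
    · simp only [hX'S x hx]
      exact ⟨fun h => absurd ⟨x, hx, h⟩ hAX, fun h => (ext_up_inl_inr hσ.root h).elim⟩
    · simp only [hSS x hx]
      rw [hu x hx]
      exact ⟨ext_up_inr hτ, ext_up_inr_inr hσ.root⟩

lemma tree_case (C : Set (Finset α)) (X : Finset α) (hlam : ∀ A ∈ C, ∀ B ∈ C, Cpt X A B) :
    ∃ (V : Type) (_ : Fintype V) (ρ : V) (rk : V → ℕ) (s : V → V) (ℓ : α → V), Sw ρ rk s ∧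
      ∀ A ∈ C, (∃ x ∈ X, x ∈ A) → Rep s ℓ X A := by
  induction X using Finset.induction_on with
  | empty =>
    exact ⟨Unit, inferInstance, (), fun _ => 0, id, fun _ => (), ⟨rfl, fun v hv => absurd rfl hv⟩,
      fun A _ h => by simp at h⟩
  | insert y X hy ih =>
    obtain ⟨V, hV, ρ, rk, s, ℓ, hs, hr⟩ := ih (fun A hA B hB => (hlam A hA B hB).mono (by simp))
    have hu : Sw () (fun _ : Unit => 0) (id : Unit → Unit) := ⟨rfl, fun v hv => absurd rfl hv⟩
    have e : insert y X = X ∪ {y} := by ext; simp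
    rw [e] at hlam ⊢
    obtain ⟨a, ha⟩ := attach hs hu ℓ (fun _ => ()) C X {y} (by
      intro x hx h; rw [Finset.mem_singleton] at h; subst h; exact hy hx) (by simp) hlam
      (fun A hA => (Cpt.small _ (by grind)).symm) hr (by
        intro A hA hx
        refine ⟨(), fun x hx' => ?_⟩
        rw [Finset.mem_singleton] at hx'
        subst hx'
        obtain ⟨z, hz, hzA⟩ := hx
        rw [Finset.mem_singleton] at hz
        subst hz
        exact ⟨fun _ => Up.refl _ _, fun _ => hzA⟩)
    exact ⟨_, inferInstance, _, _, _, _, ext_sw ρ s () id a hs hu, ha⟩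

theorem exists_BN (C1 C2 : Set (Finset α)) : ∀ (k : ℕ) (X : Finset α),
    (∀ A ∈ C1, ∀ B ∈ C1, Cpt X A B) → (∀ A ∈ C2, ∀ B ∈ C2, Cpt X A B) → PP (C1 ∪ C2) k X →
    ∃ (V : Type) (_ : Fintype V) (ρ : V) (rk : V → ℕ) (s1 s2 : V → V) (ℓ : α → V), 
      Sw ρ rk s1 ∧ Sw ρ rk s2 ∧ (Finset.univ.filter fun v => s1 v ≠ s2 v).card ≤ k ∧
      (∀ A ∈ C1, (∃ x ∈ X, x ∈ A) → Rep s1 ℓ X A) ∧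
      (∀ A ∈ C2, (∃ x ∈ X, x ∈ A) → Rep s2 ℓ X A) := by
  intro k
  induction k with
  | zero =>
    intro X h1 h2 hP
    obtain ⟨V, hV, ρ, rk, s, ℓ, hs, hr⟩ := tree_case (C1 ∪ C2) X hP
    exact ⟨V, hV, ρ, rk, s, s, ℓ, hs, hs, by simp, fun A hA => hr A (Or.inl hA),
      fun A hA => hr A (Or.inr hA)⟩
  | succ k ih =>
    rintro X h1 h2 ⟨S, hS, hS1, hS2, hP⟩
    obtain ⟨V, hV, ρ, rk, s1, s2, ℓ, hs1, hs2, hk, hr1, hr2⟩ := ih (X \ S)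
      (fun A hA B hB => (h1 A hA B hB).mono Finset.sdiff_subset)
      (fun A hA B hB => (h2 A hA B hB).mono Finset.sdiff_subset) hP
    rcases S.eq_empty_or_nonempty with h0 | h0
    · subst h0
      rw [Finset.sdiff_empty] at hr1 hr2
      exact ⟨V, hV, ρ, rk, s1, s2, ℓ, hs1, hs2, by omega, hr1, hr2⟩
    obtain ⟨W, hW, ρS, rkS, τ, ℓS, hτ, hrS⟩ := tree_case (C1 ∪ C2) S hS2
    have e : X \ S ∪ S = X := Finset.sdiff_union_of_subset hS
    obtain ⟨a1, ha1⟩ := attach hs1 hτ ℓ ℓS C1 (X \ S) S (by simp) h0 (by rwa [e])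
      (by rw [e]; exact fun A hA => hS1 A (Or.inl hA)) hr1 (fun A hA => hrS A (Or.inl hA))
    obtain ⟨a2, ha2⟩ := attach hs2 hτ ℓ ℓS C2 (X \ S) S (by simp) h0 (by rwa [e])
      (by rw [e]; exact fun A hA => hS1 A (Or.inr hA)) hr2 (fun A hA => hrS A (Or.inr hA))
    rw [e] at ha1 ha2
    refine ⟨(V × Bool) ⊕ W, inferInstance, _, _, _, _, _, ext_sw ρ s1 ρS τ a1 hs1 hτ,
      ext_sw ρ s2 ρS τ a2 hs2 hτ, ?_, ha1, ha2⟩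
    have hsub : (Finset.univ.filter fun v => ext ρ s1 ρS τ a1 v ≠ ext ρ s2 ρS τ a2 v) ⊆
        insert (.inr ρS) ((Finset.univ.filter fun v => s1 v ≠ s2 v).image
          fun v => (.inl (v, true) : (V × Bool) ⊕ W)) := by
      rintro (⟨v, b⟩ | z) hv
      · have hv := (Finset.mem_filter.1 hv).2
        cases b
        · exact absurd rfl hv
        · by_cases hvρ : v = ρ
          · simp [ext, hvρ] at hv
          · simp [ext, hvρ] at hv
            rw [Finset.mem_insert, Finset.mem_image]
            exact Or.inr ⟨v, Finset.mem_filter.2 ⟨Finset.mem_univ _, hv⟩, rfl⟩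
      · by_cases hz : z = ρS
        · simp [hz]
        · have hv := (Finset.mem_filter.1 hv).2
          simp [ext, hz] at hv
    have hfin := (Finset.card_le_card hsub).trans (Finset.card_insert_le _ _)
    have := Finset.card_image_le (s := Finset.univ.filter fun v => s1 v ≠ s2 v)
      (f := fun v => (.inl (v, true) : (V × Bool) ⊕ W))
    have hfin' := hfin.trans (Nat.add_le_add_right (this.trans hk) 1)
    refine le_trans (Finset.card_le_card ?_) hfin'
    intro v hv
    simp only [Finset.mem_filter, Finset.mem_univ, true_and] at hv ⊢
    exact hv


section
variable {V : Type}

structure Tup (X : Finset α) (ρ : V) (rk : V → ℕ) (ℓ : α → V) (K : Finset V) (s1 s2 : V → V) :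
    Prop where
  sw1 : Sw ρ rk s1
  sw2 : Sw ρ rk s2
  rK : ρ ∈ K
  lK : ∀ x ∈ X, ℓ x ∈ K
  c1 : ∀ z ∈ K, s1 z ∈ K
  c2 : ∀ z ∈ K, s2 z ∈ K
  n1 : ∀ x ∈ X, ∀ z ∈ K, s1 z ≠ ℓ x
  n2 : ∀ x ∈ X, ∀ z ∈ K, s2 z ≠ ℓ x
  eq : ∀ x ∈ X, s1 (ℓ x) = s2 (ℓ x)
  inj : ∀ x ∈ X, ∀ y ∈ X, ℓ x = ℓ y → x = y

structure Dlt (X : Finset α) (ρ : V) (ℓ : α → V) (K : Finset V) (s1 s2 : V → V) (v : V) :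
    Prop where
  vK : v ∈ K
  ne : v ≠ ρ
  nl : ∀ x ∈ X, ℓ x ≠ v
  sub : ∀ z ∈ K, ∀ z' ∈ K, (s1 z = v ∨ s2 z = v) → (s1 z' = v ∨ s2 z' = v) → z = z'
  alt : s1 v = s2 v ∨ ∀ z ∈ K, s1 z ≠ v ∧ s2 z ≠ v

def RepK (ρ : V) (ℓ : α → V) (X : Finset α) (K : Finset V) (s : V → V) (A : Finset α) : Prop :=
  ∃ w ∈ K, w ≠ ρ ∧ ∀ x ∈ X, x ∈ A ↔ Up s (ℓ x) w

noncomputable def del (s : V → V) (v z : V) : V := if s z = v then s v else s z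

variable {X : Finset α} {ρ : V} {rk : V → ℕ} {ℓ : α → V} {K : Finset V} {s s1 s2 : V → V} {v : V}

noncomputable def retc (K : Finset V) (s1 s2 : V → V) : ℕ := (K.filter fun z => s1 z ≠ s2 z).card

lemma Sw.ne (h : Sw ρ rk s) (hv : v ≠ ρ) : s v ≠ v := fun e => by
  have := h.lt v hv; rw [e] at this; omega

lemma del_sw (h : Sw ρ rk s) (hv : v ≠ ρ) : Sw ρ rk (del s v) := by
  constructor
  · simp [del, h.root, hv.symm]
  · intro z hz
    unfold del
    split_ifs with h1
    · have := h.lt z hz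
      rw [h1] at this
      exact (h.lt v hv).trans this
    · exact h.lt z hz

lemma del_ne (h : Sw ρ rk s) (hv : v ≠ ρ) (z : V) : del s v z ≠ v := by
  unfold del
  split_ifs with h1
  · exact h.ne hv
  · exact h1

lemma del_up (h : Sw ρ rk s) (hv : v ≠ ρ) {z w : V} (hz : z ≠ v) (hw : w ≠ v) :
    Up (del s v) z w ↔ Up s z w := by
  constructor
  · rintro ⟨n, rfl⟩
    clear hw hz
    induction n generalizing z with
    | zero => exact Up.refl _ _
    | succ n ih =>
      rw [Function.iterate_succ_apply]
      refine Up.trans ?_ ih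
      unfold del
      split_ifs with h1
      · exact ⟨2, by simp [h1]⟩
      · exact Up.step _ _
  · rintro ⟨n, hn⟩
    induction n using Nat.strong_induction_on generalizing z with
    | _ n ih =>
      rcases n with _ | n
      · exact ⟨0, hn⟩
      rw [Function.iterate_succ_apply] at hn
      refine (Up.step (del s v) z).trans ?_
      by_cases h1 : s z = v
      · have h2 : del s v z = s v := by simp [del, h1]
        rw [h2]
        rcases n with _ | n
        · exact absurd (hn.symm.trans h1) hw
        · rw [Function.iterate_succ_apply, h1] at hn
          exact ih n (by omega) (h.ne hv) hn
      · have h2 : del s v z = s z := by simp [del, h1]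
        rw [h2]
        exact ih n (by omega) h1 hn

lemma up_mem (hc : ∀ z ∈ K, s z ∈ K) {z w : V} (hz : z ∈ K) (h : Up s z w) : w ∈ K := by
  obtain ⟨n, rfl⟩ := h
  induction n generalizing z with
  | zero => exact hz
  | succ n ih => exact ih (hc z hz)

lemma up_child (hc : ∀ z ∈ K, s z ∈ K) {z w : V} (hz : z ∈ K) (h : Up s z w) (hne : z ≠ w) :
    ∃ c ∈ K, c ≠ w ∧ s c = w ∧ Up s z c := by
  obtain ⟨n, hn⟩ := h
  induction n with
  | zero => exact absurd hn hne
  | succ n ih =>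
    by_cases h1 : s^[n] z = w
    · exact ih h1
    · rw [Function.iterate_succ_apply'] at hn
      exact ⟨_, up_mem hc hz ⟨n, rfl⟩, h1, hn, ⟨n, rfl⟩⟩

lemma Tup.del (h : Tup X ρ rk ℓ K s1 s2) (d : Dlt X ρ ℓ K s1 s2 v) :
    Tup X ρ rk ℓ (K.erase v) (del s1 v) (del s2 v) where
  sw1 := del_sw h.sw1 d.ne
  sw2 := del_sw h.sw2 d.ne
  rK := Finset.mem_erase.2 ⟨d.ne.symm, h.rK⟩
  lK := fun x hx => Finset.mem_erase.2 ⟨d.nl x hx, h.lK x hx⟩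
  c1 := by
    intro z hz
    refine Finset.mem_erase.2 ⟨del_ne h.sw1 d.ne z, ?_⟩
    unfold Phylo.del
    split_ifs
    · exact h.c1 v d.vK
    · exact h.c1 z (Finset.mem_of_mem_erase hz)
  c2 := by
    intro z hz
    refine Finset.mem_erase.2 ⟨del_ne h.sw2 d.ne z, ?_⟩
    unfold Phylo.del
    split_ifs
    · exact h.c2 v d.vK
    · exact h.c2 z (Finset.mem_of_mem_erase hz)
  n1 := by
    intro x hx z hz
    unfold Phylo.del
    split_ifs
    · exact h.n1 x hx v d.vK
    · exact h.n1 x hx z (Finset.mem_of_mem_erase hz)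
  n2 := by
    intro x hx z hz
    unfold Phylo.del
    split_ifs
    · exact h.n2 x hx v d.vK
    · exact h.n2 x hx z (Finset.mem_of_mem_erase hz)
  eq := by
    intro x hx
    have h1 := h.eq x hx
    unfold Phylo.del
    rw [h1]
    split_ifs with h2
    · rcases d.alt with h3 | h3
      · exact h3
      · exact absurd h2 (h3 _ (h.lK x hx)).2
    · rfl
  inj := h.inj

lemma del_rep (h : Sw ρ rk s) (hv : v ≠ ρ) (hlK : ∀ x ∈ X, ℓ x ∈ K) (hc : ∀ z ∈ K, s z ∈ K)
    (hnl : ∀ x ∈ X, ℓ x ≠ v) (hsub : ∀ z ∈ K, ∀ z' ∈ K, s z = v → s z' = v → z = z')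
    {A : Finset α} (hA : ∃ x ∈ X, x ∈ A) (hr : RepK ρ ℓ X K s A) :
    RepK ρ ℓ X (K.erase v) (del s v) A := by
  obtain ⟨w, hwK, hwρ, hw⟩ := hr
  by_cases hwv : w = v
  · subst hwv
    obtain ⟨x0, hx0, hx0A⟩ := hA
    obtain ⟨c, hcK, hcw, hcs, hup⟩ := up_child hc (hlK x0 hx0) ((hw x0 hx0).1 hx0A) (hnl x0 hx0)
    refine ⟨c, Finset.mem_erase.2 ⟨hcw, hcK⟩, ?_, ?_⟩
    · rintro rfl
      exact hv (by rw [← hcs, h.root])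
    · intro x hx
      rw [hw x hx, del_up h hv (hnl x hx) hcw]
      constructor
      · intro h1
        obtain ⟨c', hcK', hcw', hcs', hup'⟩ := up_child hc (hlK x hx) h1 (hnl x hx)
        rw [hsub c hcK c' hcK' hcs hcs']
        exact hup'
      · intro h1
        exact h1.trans ⟨1, hcs⟩
  · refine ⟨w, Finset.mem_erase.2 ⟨hwv, hwK⟩, hwρ, ?_⟩
    intro x hx
    rw [hw x hx, del_up h hv (hnl x hx) hwv]

lemma Tup.del_rep1 (h : Tup X ρ rk ℓ K s1 s2) (d : Dlt X ρ ℓ K s1 s2 v) {A : Finset α}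
    (hA : ∃ x ∈ X, x ∈ A) (hr : RepK ρ ℓ X K s1 A) : RepK ρ ℓ X (K.erase v) (Phylo.del s1 v) A :=
  del_rep h.sw1 d.ne h.lK h.c1 d.nl
    (fun z hz z' hz' e e' => d.sub z hz z' hz' (Or.inl e) (Or.inl e')) hA hr

lemma Tup.del_rep2 (h : Tup X ρ rk ℓ K s1 s2) (d : Dlt X ρ ℓ K s1 s2 v) {A : Finset α}
    (hA : ∃ x ∈ X, x ∈ A) (hr : RepK ρ ℓ X K s2 A) : RepK ρ ℓ X (K.erase v) (Phylo.del s2 v) A :=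
  del_rep h.sw2 d.ne h.lK h.c2 d.nl
    (fun z hz z' hz' e e' => d.sub z hz z' hz' (Or.inr e) (Or.inr e')) hA hr

lemma Dlt.card (d : Dlt X ρ ℓ K s1 s2 v) :
    retc (K.erase v) (Phylo.del s1 v) (Phylo.del s2 v) ≤ retc K s1 s2 := by
  unfold retc
  apply Finset.card_le_card
  intro z hz
  simp only [Finset.mem_filter, Finset.mem_erase] at hz ⊢
  refine ⟨hz.1.2, fun e => hz.2 ?_⟩
  unfold Phylo.del
  rw [e]
  split_ifs with h2
  · rcases d.alt with h3 | h3
    · exact h3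
    · exact absurd h2 (h3 z hz.1.2).2
  · rfl

lemma exists_min (Q : Finset V → (V → V) → (V → V) → Prop)
    (hQ : ∀ K s1 s2 v, Tup X ρ rk ℓ K s1 s2 → Dlt X ρ ℓ K s1 s2 v → Q K s1 s2 →
      Q (K.erase v) (Phylo.del s1 v) (Phylo.del s2 v))
    (h : Tup X ρ rk ℓ K s1 s2) (hq : Q K s1 s2) :
    ∃ K' s1' s2', Tup X ρ rk ℓ K' s1' s2' ∧ Q K' s1' s2' ∧ ∀ v, ¬ Dlt X ρ ℓ K' s1' s2' v := by
  induction hn : K.card using Nat.strong_induction_on generalizing K s1 s2 with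
  | _ n ih =>
    by_cases hd : ∃ v, Dlt X ρ ℓ K s1 s2 v
    · obtain ⟨v, hd⟩ := hd
      refine ih _ ?_ (h.del hd) (hQ K s1 s2 v h hd hq) rfl
      rw [← hn]
      exact Finset.card_erase_lt_of_mem hd.vK
    · exact ⟨K, s1, s2, h, hq, fun v hv => hd ⟨v, hv⟩⟩

/-! the network of a tuple -/

lemma exists_enum (K : Finset V) : ∃ g : Fin K.card → V, Function.Injective g ∧
    ∀ v, v ∈ K ↔ ∃ i, g i = v := by
  refine ⟨fun i => (K.equivFin.symm i).1, ?_, ?_⟩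
  · intro i j h
    exact K.equivFin.symm.injective (Subtype.ext h)
  · intro v
    constructor
    · intro hv; exact ⟨K.equivFin ⟨v, hv⟩, by simp⟩
    · rintro ⟨i, rfl⟩; exact (K.equivFin.symm i).2

lemma exists_net (hX : X.Nonempty) (h : Tup X ρ rk ℓ K s1 s2) (hmin : ∀ v, ¬ Dlt X ρ ℓ K s1 s2 v) :
    ∃ (N : Net α) (g : Fin N.n → V), IsPhyloNet X N ∧ Function.Injective g ∧
      (∀ v, v ∈ K ↔ ∃ i, g i = v) ∧
      (∀ i j, N.Adj i j ↔ g j ≠ ρ ∧ (g i = s1 (g j) ∨ g i = s2 (g j))) ∧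
      (∀ i, N.IsLeaf i ↔ ∃ x ∈ X, ℓ x = g i) ∧ (∀ i, ∀ x ∈ X, ℓ x = g i → N.label i = x) ∧
      N.reticNum ≤ retc K s1 s2 := by
  unfold retc
  obtain ⟨x0, hx0⟩ := hX
  obtain ⟨g, hg, hgK⟩ := exists_enum K
  have hlab : ∀ i, ∃ y, ∀ x ∈ X, ℓ x = g i → y = x := by
    intro i
    by_cases he : ∃ x ∈ X, ℓ x = g i
    · obtain ⟨x, hx, hxi⟩ := he
      exact ⟨x, fun y hy hyi => h.inj x hx y hy (hxi.trans hyi.symm)⟩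
    · exact ⟨x0, fun y hy hyi => absurd ⟨y, hy, hyi⟩ he⟩
  choose lab hlab using hlab
  let N : Net α := ⟨K.card, Finset.univ.filter fun p => g p.2 ≠ ρ ∧ (g p.1 = s1 (g p.2) ∨
    g p.1 = s2 (g p.2)), lab⟩
  have hadj : ∀ i j : Fin N.n, N.Adj i j ↔ g j ≠ ρ ∧ (g i = s1 (g j) ∨ g i = s2 (g j)) := by
    intro i j
    simp [Net.Adj, N]
  have hadjrk : ∀ i j : Fin N.n, N.Adj i j → rk (g i) < rk (g j) := by
    intro i j hij
    obtain ⟨h1, h2 | h2⟩ := (hadj i j).1 hij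
    · rw [h2]; exact h.sw1.lt _ h1
    · rw [h2]; exact h.sw2.lt _ h1
  have hgm : ∀ i, g i ∈ K := fun i => (hgK _).2 ⟨i, rfl⟩
  have hin : ∀ j : Fin N.n, g j ≠ ρ → ∃ a b : Fin N.n, g a = s1 (g j) ∧ g b = s2 (g j) ∧
      (N.E.filter fun e => e.2 = j) = {(a, j), (b, j)} := by
    intro j hj
    obtain ⟨a, ha⟩ := (hgK _).1 (h.c1 _ (hgm j))
    obtain ⟨b, hb⟩ := (hgK _).1 (h.c2 _ (hgm j))
    refine ⟨a, b, ha, hb, ?_⟩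
    ext ⟨i, j'⟩
    simp only [Finset.mem_filter, Finset.mem_insert, Finset.mem_singleton, Prod.mk.injEq]
    constructor
    · rintro ⟨h1, rfl⟩
      obtain ⟨_, h2 | h2⟩ := (hadj i j').1 h1
      · left; exact ⟨hg (h2.trans ha.symm), rfl⟩
      · right; exact ⟨hg (h2.trans hb.symm), rfl⟩
    · rintro (⟨rfl, rfl⟩ | ⟨rfl, rfl⟩)
      · exact ⟨(hadj _ _).2 ⟨hj, Or.inl ha⟩, rfl⟩
      · exact ⟨(hadj _ _).2 ⟨hj, Or.inr hb⟩, rfl⟩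
  have hin0 : ∀ j : Fin N.n, N.indeg j = 0 ↔ g j = ρ := by
    intro j
    constructor
    · intro h0
      by_contra hj
      obtain ⟨a, b, ha, hb, he⟩ := hin j hj
      unfold Net.indeg at h0
      rw [he] at h0
      simp at h0
    · intro hj
      by_contra h0
      obtain ⟨a, ha⟩ := exists_adj_of_indeg h0
      exact ((hadj _ _).1 ha).1 hj
  have hin1 : ∀ j : Fin N.n, g j ≠ ρ → s1 (g j) = s2 (g j) → N.indeg j = 1 := by
    intro j hj he
    obtain ⟨a, b, ha, hb, hE⟩ := hin j hj
    unfold Net.indeg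
    have : a = b := hg (by rw [ha, hb, he])
    rw [hE, this]
    simp
  have hin2 : ∀ j : Fin N.n, g j ≠ ρ → s1 (g j) ≠ s2 (g j) → N.indeg j = 2 := by
    intro j hj he
    obtain ⟨a, b, ha, hb, hE⟩ := hin j hj
    unfold Net.indeg
    rw [hE, Finset.card_pair]
    intro hab
    simp only [Prod.mk.injEq, and_true] at hab
    exact he (by rw [← ha, ← hb, hab])
  have hleaf : ∀ i : Fin N.n, N.IsLeaf i ↔ ∀ j, ¬ N.Adj i j := by
    intro i
    unfold Net.IsLeaf Net.outdeg
    rw [Finset.card_eq_zero, Finset.filter_eq_empty_iff]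
    constructor
    · intro h1 j hj; exact h1 hj rfl
    · rintro h1 ⟨a, b⟩ he rfl; exact h1 b he
  have hchild : ∀ i : Fin N.n, g i ≠ ρ → ∀ z ∈ K, (s1 z = g i ∨ s2 z = g i) →
      ∃ j : Fin N.n, g j = z ∧ N.Adj i j := by
    intro i hi z hz he
    obtain ⟨j, rfl⟩ := (hgK z).1 hz
    refine ⟨j, rfl, (hadj i j).2 ⟨?_, ?_⟩⟩
    · intro e
      rw [e, h.sw1.root, h.sw2.root] at he
      rcases he with he | he <;> exact hi he.symm
    · rcases he with he | he
      · left; exact he.symm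
      · right; exact he.symm
  have hlρ : ∀ x ∈ X, ℓ x ≠ ρ := by
    intro x hx e
    exact h.n1 x hx ρ h.rK (by rw [h.sw1.root, e])
  have hleafX : ∀ i : Fin N.n, N.IsLeaf i ↔ ∃ x ∈ X, ℓ x = g i := by
    intro i
    rw [hleaf]
    constructor
    · intro hi
      by_contra hno
      by_cases hρ : g i = ρ
      · obtain ⟨c, hcK, hc1, hc2, _⟩ := up_child h.c1 (h.lK x0 hx0) (Up.root h.sw1.lt (ℓ x0))
          (hlρ x0 hx0)
        obtain ⟨j, rfl⟩ := (hgK c).1 hcK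
        exact hi j ((hadj i j).2 ⟨hc1, Or.inl (by rw [hc2, hρ])⟩)
      · have hnc : ∀ z ∈ K, ¬ (s1 z = g i ∨ s2 z = g i) := by
          intro z hz he
          obtain ⟨j, _, hj⟩ := hchild i hρ z hz he
          exact hi j hj
        refine hmin (g i) ⟨hgm i, hρ, fun x hx e => hno ⟨x, hx, e⟩, ?_, Or.inr ?_⟩
        · intro z hz z' _ he; exact absurd he (hnc z hz)
        · intro z hz; exact ⟨fun e => hnc z hz (Or.inl e), fun e => hnc z hz (Or.inr e)⟩
    · rintro ⟨x, hx, hxi⟩ j hj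
      obtain ⟨_, h2 | h2⟩ := (hadj i j).1 hj
      · exact h.n1 x hx _ (hgm j) (by rw [← h2, hxi])
      · exact h.n2 x hx _ (hgm j) (by rw [← h2, hxi])
  have hlab' : ∀ i : Fin N.n, ∀ x ∈ X, ℓ x = g i → N.label i = x := hlab
  refine ⟨N, g, ⟨?_, ?_, ?_, ?_, ?_⟩, hg, hgK, hadj, hleafX, hlab', ?_⟩
  · have : ∀ a b : Fin N.n, Relation.TransGen N.Adj a b → rk (g a) < rk (g b) := by
      intro a b hab
      induction hab with
      | single h1 => exact hadjrk _ _ h1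
      | tail _ h1 ih => exact ih.trans (hadjrk _ _ h1)
    intro v hv
    exact absurd (this v v hv) (lt_irrefl _)
  · obtain ⟨r, hr⟩ := (hgK ρ).1 h.rK
    exact ⟨r, (hin0 r).2 hr, fun y hy => hg (((hin0 y).1 hy).trans hr.symm)⟩
  · rintro i ⟨h1, h2⟩
    have hρ : g i ≠ ρ := fun e => by rw [(hin0 i).2 e] at h1; omega
    have he : s1 (g i) = s2 (g i) := by
      by_contra he; rw [hin2 i hρ he] at h1; omega
    refine hmin (g i) ⟨hgm i, hρ, ?_, ?_, Or.inl he⟩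
    · intro x hx e
      have := (hleafX i).2 ⟨x, hx, e⟩
      unfold Net.IsLeaf at this; omega
    · intro z hz z' hz' e e'
      obtain ⟨j, rfl, hj⟩ := hchild i hρ z hz e
      obtain ⟨j', rfl, hj'⟩ := hchild i hρ z' hz' e'
      unfold Net.outdeg at h2
      have h3 := Finset.card_le_one.1 (le_of_eq h2) (i, j)
        (Finset.mem_filter.2 ⟨hj, rfl⟩) (i, j') (Finset.mem_filter.2 ⟨hj', rfl⟩)
      exact congrArg g (Prod.ext_iff.1 h3).2
  · intro i h1
    have hρ : g i ≠ ρ := fun e => by rw [(hin0 i).2 e] at h1; omega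
    have he : s1 (g i) ≠ s2 (g i) := by
      intro he; rw [hin1 i hρ he] at h1; omega
    by_contra h2
    have : N.IsLeaf i := by unfold Net.IsLeaf; omega
    obtain ⟨x, hx, hxi⟩ := (hleafX i).1 this
    exact he (by rw [← hxi]; exact h.eq x hx)
  · refine ⟨?_, ?_, ?_⟩
    · intro i hi
      obtain ⟨x, hx, hxi⟩ := (hleafX i).1 hi
      rw [hlab' i x hx hxi]; exact hx
    · intro i hi j hj hij
      obtain ⟨x, hx, hxi⟩ := (hleafX i).1 hi
      obtain ⟨y, hy, hyj⟩ := (hleafX j).1 hj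
      rw [hlab' i x hx hxi, hlab' j y hy hyj] at hij
      subst hij
      exact hg (hxi.symm.trans hyj)
    · intro x hx
      obtain ⟨i, hi⟩ := (hgK _).1 (h.lK x hx)
      exact ⟨i, (hleafX i).2 ⟨x, hx, hi.symm⟩, hlab' i x hx hi.symm⟩
  · unfold Net.reticNum
    calc ∑ v, (N.indeg v - 1) ≤ ∑ v : Fin N.n, (if s1 (g v) ≠ s2 (g v) then 1 else 0) := by
          apply Finset.sum_le_sum
          intro v _
          by_cases hρ : g v = ρ
          · rw [(hin0 v).2 hρ]; simp
          · by_cases he : s1 (g v) = s2 (g v)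
            · rw [hin1 v hρ he]; simp
            · rw [hin2 v hρ he]; simp [he]
      _ = (Finset.univ.filter fun v : Fin N.n => s1 (g v) ≠ s2 (g v)).card := by
          rw [Finset.card_filter]
      _ ≤ _ := by
          refine Finset.card_le_card_of_injOn g ?_ hg.injOn
          intro v hv
          simp only [Finset.coe_filter, Finset.mem_univ, true_and, Set.mem_setOf_eq] at hv ⊢
          exact ⟨hgm v, hv⟩

end


section
variable {V : Type}

def Disp (ρ : V) (σ : V → V) (K0 K : Finset V) (s : V → V) : Prop :=
  K ⊆ K0 ∧ ∃ k : V → ℕ,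
    (∀ z ∈ K, z ≠ ρ → 1 ≤ k z ∧ σ^[k z] z = s z ∧ ∀ j, 0 < j → j < k z → σ^[j] z ∉ K) ∧
    (∀ z ∈ K, ∀ z' ∈ K, z ≠ ρ → z' ≠ ρ → z ≠ z' → ∀ j j', 0 < j → j < k z → 0 < j' → j' < k z' →
      σ^[j] z ≠ σ^[j'] z')

variable {X : Finset α} {ρ : V} {rk : V → ℕ} {ℓ : α → V} {K K0 : Finset V} {s s1 s2 σ : V → V}
  {v : V}

lemma Disp.del (hd : Disp ρ σ K0 K s) (h : Tup X ρ rk ℓ K s s) (d : Dlt X ρ ℓ K s s v) :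
    Disp ρ σ K0 (K.erase v) (Phylo.del s v) := by
  obtain ⟨hK, k, h1, h2⟩ := hd
  have hv := h1 v d.vK d.ne
  have key : ∀ z ∈ K, z ≠ ρ → ∀ j, 0 < j → j < (if s z = v then k z + k v else k z) →
      j < k z ∨ (s z = v ∧ σ^[j] z = v) ∨ (s z = v ∧ ∃ i, 0 < i ∧ i < k v ∧ σ^[j] z = σ^[i] v) := by
    intro z hz hzρ j hj hjk
    by_cases hzv : s z = v
    · rw [if_pos hzv] at hjk
      rcases lt_trichotomy j (k z) with h3 | h3 | h3
      · exact Or.inl h3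
      · right; left; rw [h3, (h1 z hz hzρ).2.1]; exact ⟨hzv, hzv⟩
      · right; right
        refine ⟨hzv, j - k z, by omega, by omega, ?_⟩
        have h4 : j = (j - k z) + k z := by omega
        conv_lhs => rw [h4, Function.iterate_add_apply, (h1 z hz hzρ).2.1, hzv]
    · rw [if_neg hzv] at hjk; exact Or.inl hjk
  refine ⟨(Finset.erase_subset _ _).trans hK, fun z => if s z = v then k z + k v else k z, ?_, ?_⟩
  · intro z hz hzρ
    rw [Finset.mem_erase] at hz
    have hz1 := h1 z hz.2 hzρ
    refine ⟨?_, ?_, ?_⟩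
    · show 1 ≤ (if s z = v then k z + k v else k z)
      split_ifs <;> omega
    · unfold Phylo.del
      simp only
      split_ifs with h3
      · rw [add_comm, Function.iterate_add_apply, hz1.2.1, h3, hv.2.1]
      · exact hz1.2.1
    · intro j hj hjk hmem
      rw [Finset.mem_erase] at hmem
      rcases key z hz.2 hzρ j hj hjk with h3 | ⟨h3, h4⟩ | ⟨h3, i, hi, hi', h4⟩
      · exact hz1.2.2 j hj h3 hmem.2
      · exact hmem.1 h4
      · rw [h4] at hmem
        exact hv.2.2 i hi hi' hmem.2
  · intro z hz z' hz' hzρ hzρ' hne j j' hj hjk hj' hjk' e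
    rw [Finset.mem_erase] at hz hz'
    have hz1 := h1 z hz.2 hzρ
    have hz1' := h1 z' hz'.2 hzρ'
    rcases key z hz.2 hzρ j hj hjk with h3 | ⟨h3, h4⟩ | ⟨h3, i, hi, hi', h4⟩
    · rcases key z' hz'.2 hzρ' j' hj' hjk' with h5 | ⟨h5, h6⟩ | ⟨h5, i', hi1, hi1', h6⟩
      · exact h2 z hz.2 z' hz'.2 hzρ hzρ' hne j j' hj h3 hj' h5 e
      · apply hz1.2.2 j hj h3
        rw [e, h6]; exact d.vK
      · rw [h6] at e
        exact h2 z hz.2 v d.vK hzρ d.ne hz.1 j i' hj h3 hi1 hi1' e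
    · rcases key z' hz'.2 hzρ' j' hj' hjk' with h5 | ⟨h5, h6⟩ | ⟨h5, i', hi1, hi1', h6⟩
      · apply hz1'.2.2 j' hj' h5
        rw [← e, h4]; exact d.vK
      · exact hne (d.sub z hz.2 z' hz'.2 (Or.inl h3) (Or.inl h5))
      · exact hne (d.sub z hz.2 z' hz'.2 (Or.inl h3) (Or.inl h5))
    · rcases key z' hz'.2 hzρ' j' hj' hjk' with h5 | ⟨h5, h6⟩ | ⟨h5, i', hi1, hi1', h6⟩
      · rw [h4] at e
        exact h2 v d.vK z' hz'.2 d.ne hzρ' hz'.1.symm i j' hi hi' hj' h5 e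
      · exact hne (d.sub z hz.2 z' hz'.2 (Or.inl h3) (Or.inl h5))
      · exact hne (d.sub z hz.2 z' hz'.2 (Or.inl h3) (Or.inl h5))

lemma Tup.left (h : Tup X ρ rk ℓ K s1 s2) : Tup X ρ rk ℓ K s1 s1 :=
  ⟨h.sw1, h.sw1, h.rK, h.lK, h.c1, h.c1, h.n1, h.n1, fun _ _ => rfl, h.inj⟩

lemma Tup.right (h : Tup X ρ rk ℓ K s1 s2) : Tup X ρ rk ℓ K s2 s2 :=
  ⟨h.sw2, h.sw2, h.rK, h.lK, h.c2, h.c2, h.n2, h.n2, fun _ _ => rfl, h.inj⟩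

lemma of_mem_internals {β : Type*} {p : List β} {w : β} (hw : w ∈ internals p) :
    ∃ (i : ℕ) (hi : i < p.length), 0 < i ∧ i + 1 < p.length ∧ p[i] = w := by
  unfold internals at hw
  rw [List.mem_iff_getElem] at hw
  obtain ⟨i, hi, rfl⟩ := hw
  simp only [List.length_dropLast, List.length_tail] at hi
  exact ⟨i + 1, by omega, by omega, by omega, by simp⟩

lemma represents_of_switch (hX : X.Nonempty) (h : Tup X ρ rk ℓ K σ σ) {N : Net α} {g : Fin N.n → V}
    (hg : Function.Injective g) (hgK : ∀ v, v ∈ K ↔ ∃ i, g i = v)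
    (hadj : ∀ i j, g j ≠ ρ → g i = σ (g j) → N.Adj i j)
    (hleaf : ∀ i, N.IsLeaf i ↔ ∃ x ∈ X, ℓ x = g i) (hlab : ∀ i, ∀ x ∈ X, ℓ x = g i → N.label i = x)
    {A : Finset α} (hAX : A ⊆ X) (hA : A.Nonempty) (hr : RepK ρ ℓ X K σ A) :
    RepresentsCluster X N A := by
  have hA' : ∃ x ∈ X, x ∈ A := by obtain ⟨x, hx⟩ := hA; exact ⟨x, hAX hx, hx⟩
  obtain ⟨K', s, s', hT, ⟨rfl, hr', hD⟩, hmin⟩ := exists_min (X := X) (ρ := ρ) (rk := rk) (ℓ := ℓ)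
    (K := K) (s1 := σ) (s2 := σ)
    (fun K' s s' => s = s' ∧ RepK ρ ℓ X K' s A ∧ Disp ρ σ K K' s) (by
      rintro K1 t1 t2 v hT hd ⟨rfl, hr1, hD1⟩
      exact ⟨rfl, hT.del_rep1 hd hA' hr1, hD1.del hT hd⟩) h
    ⟨rfl, hr, subset_rfl, fun _ => 1, fun z _ _ => ⟨le_rfl, rfl, fun j h1 h2 => by have h3 : j < 1 := h2; omega⟩,
      fun z _ z' _ _ _ _ j j' h1 h2 => by have h3 : j < 1 := h2; omega⟩
  obtain ⟨T, g', hTp, hg', hgK', hadj', hleaf', hlab', hret⟩ := exists_net hX hT hmin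
  obtain ⟨hKK, k, hk1, hk2⟩ := hD
  have hgm' : ∀ i, g' i ∈ K' := fun i => (hgK' _).2 ⟨i, rfl⟩
  have hTt : IsPhyloTree X T := by
    refine ⟨hTp, ?_⟩
    simp [retc] at hret
    exact hret
  have hNe : Nonempty (Fin N.n) := by
    obtain ⟨i, _⟩ := (hgK ρ).1 h.rK
    exact ⟨i⟩
  have hinv : ∀ v, ∃ i, v ∈ K → g i = v := by
    intro v
    by_cases hv : v ∈ K
    · obtain ⟨i, hi⟩ := (hgK v).1 hv; exact ⟨i, fun _ => hi⟩
    · exact ⟨Classical.choice hNe, fun h => absurd h hv⟩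
  choose ψ hψ using hinv
  have horb : ∀ z ∈ K', ∀ j, σ^[j] z ∈ K := fun z hz j => up_mem h.c1 (hKK hz) ⟨j, rfl⟩
  refine ⟨T, hTt, ⟨fun i => ψ (g' i), ?_, ?_, fun e => (List.range (k (g' e.2) + 1)).map
    (fun j => ψ (σ^[k (g' e.2) - j] (g' e.2))), ?_, ?_, ?_⟩, ?_⟩
  · intro i j hij
    apply hg'
    have := congrArg g hij
    simpa only [hψ _ (hKK (hgm' i)), hψ _ (hKK (hgm' j))] using this
  · intro i hi
    obtain ⟨x, hx, hxi⟩ := (hleaf' i).1 hi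
    have e : ℓ x = g (ψ (g' i)) := by rw [hψ _ (hKK (hgm' i)), hxi]
    exact ⟨(hleaf _).2 ⟨x, hx, e⟩, by rw [hlab _ x hx e, hlab' i x hx hxi]⟩
  · rintro ⟨a, b⟩ hab
    have hab' := (hadj' a b).1 hab
    simp only [or_self] at hab'
    obtain ⟨k1, k2, k3⟩ := hk1 (g' b) (hgm' b) hab'.1
    refine ⟨?_, ?_, ?_, ?_⟩
    · simp only [List.head?_eq_getElem?]
      rw [List.getElem?_eq_getElem (by simp)]
      simp [k2, hab'.2]
    · rw [List.getLast?_eq_getElem?]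
      rw [List.getElem?_eq_getElem (by simp)]
      simp
    · refine List.isChain_iff_getElem.2 ?_
      intro i hi
      simp only [List.length_map, List.length_range] at hi
      simp only [List.getElem_map, List.getElem_range]
      apply hadj
      · rw [hψ _ (horb _ (hgm' b) _)]
        rcases Nat.eq_zero_or_pos (k (g' b) - (i + 1)) with h0 | h0
        · rw [h0]; exact hab'.1
        · intro e
          apply k3 _ h0 (by omega)
          rw [e]; exact hT.rK
      · rw [hψ _ (horb _ (hgm' b) _), hψ _ (horb _ (hgm' b) _)]
        rw [← Function.iterate_succ_apply' σ]
        congr 1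
        omega
    · simp; omega
  · rintro ⟨a, b⟩ hab w hw
    have hab' := (hadj' a b).1 hab
    obtain ⟨k1, k2, k3⟩ := hk1 (g' b) (hgm' b) hab'.1
    obtain ⟨i, hi, h0, h1, rfl⟩ := of_mem_internals hw
    simp only [List.length_map, List.length_range] at h1
    rintro ⟨c, hc⟩
    simp only [List.getElem_map, List.getElem_range] at hc
    have := congrArg g hc
    rw [hψ _ (hKK (hgm' c)), hψ _ (horb _ (hgm' b) _)] at this
    apply k3 (k (g' b) - i) (by omega) (by omega)
    rw [← this]; exact hgm' c
  · rintro ⟨a, b⟩ hab ⟨c, d⟩ hcd hne w hw hw'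
    have hab' := (hadj' a b).1 hab
    have hcd' := (hadj' c d).1 hcd
    simp only [or_self] at hab' hcd'
    obtain ⟨i, hi, h0, h1, rfl⟩ := of_mem_internals hw
    obtain ⟨i', hi', h0', h1', e⟩ := of_mem_internals hw'
    simp only [List.length_map, List.length_range] at h1 h1'
    simp only [List.getElem_map, List.getElem_range] at e
    have := congrArg g e
    rw [hψ _ (horb _ (hgm' b) _), hψ _ (horb _ (hgm' d) _)] at this
    refine hk2 (g' d) (hgm' d) (g' b) (hgm' b) hcd'.1 hab'.1 ?_ _ _ (by omega) (by omega)
      (by omega) (by omega) this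
    intro hdb
    have hdb' := hg' hdb
    subst hdb'
    apply hne
    rw [hg' (hab'.2.trans hcd'.2.symm)]
  · obtain ⟨w, hwK, hwρ, hw⟩ := hr'
    obtain ⟨b, rfl⟩ := (hgK' w).1 hwK
    obtain ⟨a, ha⟩ := (hgK' _).1 (hT.c1 _ hwK)
    have hab : T.Adj a b := (hadj' a b).2 ⟨hwρ, Or.inl ha⟩
    refine ⟨(a, b), hab, ?_⟩
    have hreach : ∀ i j, T.Reaches i j ↔ Up s (g' j) (g' i) := by
      intro i j
      constructor
      · intro hij
        induction hij with
        | refl => exact Up.refl _ _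
        | tail _ h1 ih =>
          have h2 := (hadj' _ _).1 h1
          simp only [or_self] at h2
          refine Up.trans ⟨1, ?_⟩ ih
          exact h2.2.symm
      · rintro ⟨n, hn⟩
        induction n generalizing j with
        | zero => rw [hg' hn]; exact Relation.ReflTransGen.refl
        | succ n ih =>
          rw [Function.iterate_succ_apply] at hn
          by_cases hj : g' j = ρ
          · rw [hj, hT.sw1.root] at hn
            exact ih j (by rw [hj]; exact hn)
          · obtain ⟨p, hp⟩ := (hgK' _).1 (hT.c1 _ (hgm' j))
            rw [← hp] at hn
            exact (ih p hn).tail ((hadj' p j).2 ⟨hj, Or.inl hp⟩)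
    obtain ⟨m, hm⟩ := exists_leafmap hTp
    ext x
    rw [mem_clusterBelow hTp hm, hreach]
    constructor
    · rintro ⟨hx, h1⟩
      obtain ⟨i, hi⟩ := (hgK' _).1 (hT.lK x hx)
      have : i = m x := (hm x hx).2.2 i ((hleaf' i).2 ⟨x, hx, hi.symm⟩) (hlab' i x hx hi.symm)
      rw [← this, hi] at h1
      exact (hw x hx).2 h1
    · intro hxA
      have hx := hAX hxA
      refine ⟨hx, ?_⟩
      obtain ⟨i, hi⟩ := (hgK' _).1 (hT.lK x hx)
      have : i = m x := (hm x hx).2.2 i ((hleaf' i).2 ⟨x, hx, hi.symm⟩) (hlab' i x hx hi.symm)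
      rw [← this, hi]
      exact (hw x hx).1 hxA

end

section pend
variable {V : Type}

noncomputable def pend (ρ : V) (s : V → V) (ℓ : α → V) : Option (V ⊕ α) → Option (V ⊕ α)
  | none => none
  | some (.inl v) => if v = ρ then none else some (.inl (s v))
  | some (.inr x) => some (.inl (ℓ x))

variable {ρ : V} {s : V → V} {ℓ : α → V} {rk : V → ℕ}

def pendRk (rk : V → ℕ) (ℓ : α → V) : Option (V ⊕ α) → ℕ
  | none => 0
  | some (.inl v) => rk v + 1
  | some (.inr x) => rk (ℓ x) + 2

lemma pend_inl (v : V) : pend ρ s ℓ (some (.inl v)) = if v = ρ then none else some (.inl (s v)) :=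
  rfl

lemma pend_sw (h : Sw ρ rk s) : Sw none (pendRk rk ℓ) (pend ρ s ℓ) := by
  constructor
  · rfl
  · rintro (_ | v | x) hv
    · exact absurd rfl hv
    · rw [pend_inl]
      split_ifs with h1
      · simp [pendRk]
      · have := h.lt v h1
        simp [pendRk]; omega
    · simp [pend, pendRk]

lemma pend_up (h : Sw ρ rk s) (y w : V) :
    Up (pend ρ s ℓ) (some (.inl y)) (some (.inl w)) ↔ Up s y w := by
  constructor
  · rintro ⟨n, hn⟩
    induction n generalizing y with
    | zero => exact ⟨0, by simpa using hn⟩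
    | succ n ih =>
      rw [Function.iterate_succ_apply] at hn
      rw [pend_inl] at hn
      split_ifs at hn with h1
      · have := Up.fixed (s := pend ρ s ℓ) (ρ := none) rfl ⟨n, hn⟩
        simp at this
      · exact (Up.step s y).trans (ih _ hn)
  · rintro ⟨n, rfl⟩
    induction n generalizing y with
    | zero => exact Up.refl _ _
    | succ n ih =>
      rw [Function.iterate_succ_apply]
      by_cases hy : y = ρ
      · subst hy; rw [h.root]; exact ih y
      · refine Up.trans ⟨1, ?_⟩ (ih (s y))
        simp [pend, hy]

theorem exists_of_PP {X : Finset α} (hX : X.Nonempty) (C1 C2 : Set (Finset α)) (k : ℕ)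
    (h1 : ∀ A ∈ C1, ∀ B ∈ C1, Cpt X A B) (h2 : ∀ A ∈ C2, ∀ B ∈ C2, Cpt X A B)
    (hm : ∀ A ∈ C1 ∪ C2, A.Nonempty ∧ A ⊆ X)
    (hP : PP (C1 ∪ C2) k X) :
    ∃ N : Net α, IsPhyloNet X N ∧ RepresentsSet X N (C1 ∪ C2) ∧ N.reticNum ≤ k := by
  obtain ⟨V, hV, ρ, rk, s1, s2, ℓ, hs1, hs2, hk, hr1, hr2⟩ := exists_BN C1 C2 k X h1 h2 hP
  have hne : ∀ A ∈ C1 ∪ C2, ∃ x ∈ X, x ∈ A := by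
    intro A hA
    obtain ⟨⟨x, hx⟩, h3⟩ := hm A hA
    exact ⟨x, h3 hx, hx⟩
  let K : Finset (Option (V ⊕ α)) := insert none ((Finset.univ.image fun v => some (.inl v)) ∪
    X.image fun x => some (.inr x))
  have hK1 : ∀ v : V, some (.inl v) ∈ K := by intro v; simp [K]
  have hK2 : ∀ x ∈ X, some (.inr x) ∈ K := by intro x hx; simp [K, hx]
  have hK0 : none ∈ K := by simp [K]
  have hc : ∀ s : V → V, ∀ z, pend ρ s ℓ z ∈ K := by
    rintro s (_ | v | x)
    · exact hK0
    · rw [pend_inl]; split_ifs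
      · exact hK0
      · exact hK1 _
    · exact hK1 _
  have hn : ∀ s : V → V, ∀ x z, pend ρ s ℓ z ≠ some (.inr x) := by
    rintro s x (_ | v | y)
    · simp [pend]
    · rw [pend_inl]; split_ifs <;> simp
    · simp [pend]
  have hT : Tup X none (pendRk rk ℓ) (fun x => some (.inr x)) K (pend ρ s1 ℓ) (pend ρ s2 ℓ) :=
    ⟨pend_sw hs1, pend_sw hs2, hK0, hK2, fun z _ => hc _ z, fun z _ => hc _ z,
      fun x _ z _ => hn _ x z, fun x _ z _ => hn _ x z, fun _ _ => rfl, by simp⟩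
  have hrep : ∀ s, Sw ρ rk s → ∀ A, Rep s ℓ X A →
      RepK none (fun x => some (.inr x)) X K (pend ρ s ℓ) A := by
    rintro s hs A ⟨w, hw⟩
    refine ⟨some (.inl w), hK1 w, by simp, fun x hx => ?_⟩
    rw [hw x hx, ← pend_up (ℓ := ℓ) hs]
    constructor
    · intro h; exact (Up.step _ _).trans h
    · intro h
      rcases h.cases with h | h
      · simp at h
      · exact h
  obtain ⟨K', t1, t2, hT', ⟨hq1, hq2, hq3⟩, hmin⟩ := exists_min
    (fun K s1 s2 => retc K s1 s2 ≤ k ∧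
      (∀ A ∈ C1, RepK none (fun x => some (.inr x)) X K s1 A) ∧
      (∀ A ∈ C2, RepK none (fun x => some (.inr x)) X K s2 A)) (by
      rintro K u1 u2 v hT hd ⟨q1, q2, q3⟩
      exact ⟨hd.card.trans q1, fun A hA => hT.del_rep1 hd (hne A (Or.inl hA)) (q2 A hA),
        fun A hA => hT.del_rep2 hd (hne A (Or.inr hA)) (q3 A hA)⟩) hT
    ⟨by
      refine le_trans ?_ hk
      unfold retc
      have hsub : (K.filter fun z => pend ρ s1 ℓ z ≠ pend ρ s2 ℓ z) ⊆
          (Finset.univ.filter fun v => s1 v ≠ s2 v).image fun v => some (.inl v) := by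
        rintro (_ | v | x) hz
        · exact absurd rfl (Finset.mem_filter.1 hz).2
        · have hz := (Finset.mem_filter.1 hz).2
          by_cases hv : v = ρ
          · simp [pend, hv] at hz
          · simp [pend, hv] at hz
            rw [Finset.mem_image]
            exact ⟨v, Finset.mem_filter.2 ⟨Finset.mem_univ _, hz⟩, rfl⟩
        · exact absurd rfl (Finset.mem_filter.1 hz).2
      exact (Finset.card_le_card (by convert hsub)).trans Finset.card_image_le,
    fun A hA => hrep s1 hs1 A (hr1 A hA (hne A (Or.inl hA))),
    fun A hA => hrep s2 hs2 A (hr2 A hA (hne A (Or.inr hA)))⟩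
  obtain ⟨N, g, hN, hg, hgK, hadj, hleaf, hlab, hret⟩ := exists_net hX hT' hmin
  refine ⟨N, hN, ?_, hret.trans hq1⟩
  intro A hA
  have hA' := hm A hA
  rcases hA with hA | hA
  · exact represents_of_switch hX hT'.left hg hgK
      (fun i j h3 h4 => (hadj i j).2 ⟨h3, Or.inl h4⟩) hleaf hlab hA'.2 hA'.1 (hq2 A hA)
  · exact represents_of_switch hX hT'.right hg hgK
      (fun i j h3 h4 => (hadj i j).2 ⟨h3, Or.inr h4⟩) hleaf hlab hA'.2 hA'.1 (hq3 A hA)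

end pend

lemma displays_self (T : Net α) : Displays T T := by
  refine ⟨id, Function.injective_id, fun v hv => ⟨hv, rfl⟩, fun e => [e.1, e.2], ?_, ?_, ?_⟩
  · intro e he
    refine ⟨rfl, rfl, ?_, by simp⟩
    exact List.isChain_pair.2 he
  · intro e he w hw
    simp [internals] at hw
  · intro e he f hf hne w hw
    simp [internals] at hw

lemma clSet_laminar {X : Finset α} {T : Net α} (h : IsPhyloTree X T) :
    ∀ A ∈ clSet T, ∀ B ∈ clSet T, Cpt X A B := by
  have := PP_of_net (𝒞 := clSet T) h.1 (by
    rintro C ⟨e, he, rfl⟩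
    exact ⟨T, h, displays_self T, e, he, rfl⟩)
  rw [h.2] at this
  exact this

lemma reaches_leaf {N : Net α} (h : Acyc N) : ∀ v, ∃ w, N.Reaches v w ∧ N.IsLeaf w := by
  intro v
  obtain ⟨w, hw, hmax⟩ := Finset.exists_max_image (Finset.univ.filter fun w => N.Reaches v w)
    (nrk N) ⟨v, Finset.mem_filter.2 ⟨Finset.mem_univ _, Relation.ReflTransGen.refl⟩⟩
  simp only [Finset.mem_filter, Finset.mem_univ, true_and] at hw hmax
  refine ⟨w, hw, ?_⟩
  by_contra hl
  unfold Net.IsLeaf Net.outdeg at hl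
  obtain ⟨⟨a, b⟩, he⟩ := Finset.card_ne_zero.1 hl
  simp only [Finset.mem_filter] at he
  obtain ⟨he, rfl⟩ := he
  have h1 : N.Adj a b := he
  have := hmax b (hw.tail h1)
  have := nrk_lt h h1
  omega

lemma clusterBelow_mem {X : Finset α} {N : Net α} (h : IsPhyloNet X N) (v : Fin N.n) :
    (N.clusterBelow v).Nonempty ∧ N.clusterBelow v ⊆ X := by
  constructor
  · obtain ⟨w, h1, h2⟩ := reaches_leaf h.1 v
    exact ⟨N.label w, Finset.mem_image.2 ⟨w, by simp [h1, h2], rfl⟩⟩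
  · obtain ⟨ℓ, hℓ⟩ := exists_leafmap h
    intro x hx
    exact ((mem_clusterBelow h hℓ v x).1 hx).1

lemma net_nonempty {X : Finset α} {N : Net α} (h : IsPhyloNet X N) : X.Nonempty := by
  obtain ⟨ρ, _⟩ := h.2.1
  obtain ⟨h1, h2⟩ := clusterBelow_mem h ρ
  exact h1.mono h2

lemma rNum_empty (𝒞 : Set (Finset α)) : rNum ∅ 𝒞 = 0 := by
  unfold rNum
  convert Nat.sInf_empty
  rw [Set.eq_empty_iff_forall_notMem]
  rintro k ⟨N, hN, _⟩
  simpa using net_nonempty hN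

/-- a union of two laminar families of nonempty subsets -/
structure Two (X : Finset α) (𝒞 : Set (Finset α)) : Prop where
  ne : X.Nonempty
  two : ∃ C1 C2 : Set (Finset α), 𝒞 = C1 ∪ C2 ∧ (∀ A ∈ C1, ∀ B ∈ C1, Cpt X A B) ∧
    (∀ A ∈ C2, ∀ B ∈ C2, Cpt X A B)
  mem : ∀ A ∈ 𝒞, A.Nonempty ∧ A ⊆ X

lemma Two.le {X : Finset α} {𝒞 : Set (Finset α)} (h : Two X 𝒞) {k : ℕ} (hk : PP 𝒞 k X) :
    rNum X 𝒞 ≤ k := by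
  obtain ⟨C1, C2, rfl, h1, h2⟩ := h.two
  obtain ⟨N, hN, hR, hle⟩ := exists_of_PP h.ne C1 C2 k h1 h2 h.mem hk
  refine le_trans ?_ hle
  unfold rNum
  exact Nat.sInf_le ⟨N, hN, hR, rfl⟩

lemma Two.pp {X : Finset α} {𝒞 : Set (Finset α)} (h : Two X 𝒞) : PP 𝒞 (rNum X 𝒞) X := by
  have hm : rNum X 𝒞 ∈ {k | ∃ N : Net α, IsPhyloNet X N ∧ RepresentsSet X N 𝒞 ∧ N.reticNum = k} := by
    apply Nat.sInf_mem
    obtain ⟨k, hk⟩ := PP.exists 𝒞 X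
    obtain ⟨C1, C2, rfl, h1, h2⟩ := h.two
    obtain ⟨N, hN, hR, hle⟩ := exists_of_PP h.ne C1 C2 k h1 h2 h.mem hk
    exact ⟨_, N, hN, hR, rfl⟩
  obtain ⟨N, hN, hR, he⟩ := hm
  rw [← he]
  exact PP_of_net hN hR

lemma restrictTo_two {X U : Finset α} {𝒞 : Set (Finset α)} (h : Two X 𝒞) (hU : U ⊆ X)
    (hne : U.Nonempty) : Two U (restrictTo 𝒞 U) := by
  refine ⟨hne, ?_, ?_⟩
  · obtain ⟨C1, C2, rfl, h1, h2⟩ := h.two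
    have key : ∀ C : Set (Finset α), (∀ A ∈ C, ∀ B ∈ C, Cpt X A B) →
        ∀ A ∈ restrictTo C U, ∀ B ∈ restrictTo C U, Cpt U A B := by
      rintro C hC _ ⟨_, A, hA, rfl⟩ _ ⟨_, B, hB, rfl⟩
      refine Cpt.pull id (fun y hy => hU hy) (hC A hA B hB) ?_ ?_ <;>
        (intro y hy; simp [hy])
    refine ⟨restrictTo C1 U, restrictTo C2 U, ?_, key _ h1, key _ h2⟩
    ext D
    simp only [restrictTo, Set.mem_setOf_eq, Set.mem_union]
    grind
  · rintro _ ⟨h1, A, hA, rfl⟩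
    exact ⟨h1, Finset.inter_subset_right⟩

lemma restrictTo_pp {U : Finset α} {𝒞 : Set (Finset α)} (k : ℕ) :
    PP (restrictTo 𝒞 U) k U ↔ PP 𝒞 k U := by
  constructor
  · refine PP.pull id k U U (fun y hy => hy) fun A hA => ?_
    by_cases h : (A ∩ U).Nonempty
    · exact Or.inr ⟨A ∩ U, ⟨h, A, hA, rfl⟩, fun y hy => by simp [hy]⟩
    · left
      intro x hx y hy hxA
      exact absurd ⟨x, Finset.mem_inter.2 ⟨hxA, hx⟩⟩ h
  · refine PP.pull id k U U (fun y hy => hy) ?_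
    rintro _ ⟨_, A, hA, rfl⟩
    exact Or.inr ⟨A, hA, fun y hy => by simp [hy]⟩

/-- the collapsed cluster -/
def colp (U : Finset α) (u : α) (C : Finset α) : Finset α :=
  if (C ∩ U).Nonempty then (C \ U) ∪ {u} else C

lemma mem_colp {U C : Finset α} {u y : α} (hu : u ∉ C) (hy : y ∉ U) :
    y ∈ colp U u C ↔ (y = u ∧ (C ∩ U).Nonempty) ∨ (y ∈ C) := by
  unfold colp
  split_ifs with h
  · simp [h, hy]
  · simp [h]

lemma colp_cases {X U A : Finset α} {u u0 : α} (hu0 : u0 ∈ U) (hUX : U ⊆ X) (hu : u ∉ X)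
    (hA : A ⊆ X) (hAU : Compatible A U) :
    (∀ x, x ∈ X \ U ∪ {u} → x ∈ colp U u A → x = u) ∧ (∀ x, x ∈ X \ U ∪ {u0} → x ∈ A → x = u0) ∨
    (∀ y ∈ X \ U ∪ {u}, y ∈ colp U u A ↔ (if y = u then u0 else y) ∈ A) := by
  have huA : u ∉ A := fun h => hu (hA h)
  have huU : u ∉ U := fun h => hu (hUX h)
  rcases hAU with h | h | h
  · right
    intro y hy
    have hyU : y ∉ U := by grind
    rw [mem_colp huA hyU, h]
    split_ifs with h1
    · subst h1
      have : u0 ∉ A := fun h2 => by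
        have : u0 ∈ A ∩ U := Finset.mem_inter.2 ⟨h2, hu0⟩
        simp [h] at this
      simp [huA, this]
    · simp
  · left
    constructor
    · intro x hx
      have hyU : x ∉ U := by grind
      rw [mem_colp huA hyU]
      rintro (h1 | h1)
      · exact h1.1
      · exact absurd (h h1) hyU
    · intro x hx hxA
      have := h hxA
      grind
  · right
    intro y hy
    have hyU : y ∉ U := by grind
    rw [mem_colp huA hyU]
    have h2 : (A ∩ U).Nonempty := ⟨u0, Finset.mem_inter.2 ⟨h hu0, hu0⟩⟩
    split_ifs with h1
    · simp [h1, h2, h hu0]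
    · simp [h1]

lemma collapseTo_two {X U : Finset α} {u u0 : α} {𝒞 : Set (Finset α)} (h : Two X 𝒞) (hUX : U ⊆ X)
    (hu0 : u0 ∈ U) (hu : u ∉ X) (hU : Unseparated 𝒞 U) :
    Two (X \ U ∪ {u}) (collapseTo 𝒞 U u) := by
  refine ⟨⟨u, by simp⟩, ?_, ?_⟩
  · obtain ⟨C1, C2, rfl, h1, h2⟩ := h.two
    have key : ∀ C ⊆ C1 ∪ C2, (∀ A ∈ C, ∀ B ∈ C, Cpt X A B) →
        ∀ A ∈ collapseTo C U u, ∀ B ∈ collapseTo C U u, Cpt (X \ U ∪ {u}) A B := by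
      rintro C hs hC _ ⟨A, hA, rfl⟩ _ ⟨B, hB, rfl⟩
      change Cpt _ (colp U u A) (colp U u B)
      rcases colp_cases hu0 hUX hu (h.mem A (hs hA)).2 (hU A (hs hA)) with h3 | h3
      · exact Cpt.small _ fun x hx y hy hxA hyA => (h3.1 x hx hxA).trans (h3.1 y hy hyA).symm
      rcases colp_cases hu0 hUX hu (h.mem B (hs hB)).2 (hU B (hs hB)) with h4 | h4
      · exact (Cpt.small _ fun x hx y hy hxA hyA => (h4.1 x hx hxA).trans (h4.1 y hy hyA).symm).symm
      refine Cpt.pull _ ?_ (hC A hA B hB) h3 h4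
      intro y hy
      have := hUX hu0
      grind
    refine ⟨collapseTo C1 U u, collapseTo C2 U u, ?_, key _ Set.subset_union_left h1,
      key _ Set.subset_union_right h2⟩
    ext D
    simp only [collapseTo, Set.mem_setOf_eq, Set.mem_union]
    grind
  · rintro _ ⟨A, hA, rfl⟩
    obtain ⟨h1, h2⟩ := h.mem A hA
    split_ifs with h3
    · refine ⟨⟨u, by simp⟩, ?_⟩
      intro x hx
      have := @h2 x
      grind
    · refine ⟨h1, ?_⟩
      intro x hx
      have h4 := h2 hx
      have h5 : x ∉ U := fun h5 => h3 ⟨x, Finset.mem_inter.2 ⟨hx, h5⟩⟩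
      simp [h4, h5]

lemma collapseTo_pp {X U : Finset α} {u u0 : α} {𝒞 : Set (Finset α)} (h : Two X 𝒞) (hUX : U ⊆ X)
    (hu0 : u0 ∈ U) (hu : u ∉ X) (hU : Unseparated 𝒞 U) (k : ℕ) :
    PP (collapseTo 𝒞 U u) k (X \ U ∪ {u}) ↔ PP 𝒞 k (X \ U ∪ {u0}) := by
  have huU : u ∉ U := fun h => hu (hUX h)
  constructor
  · refine PP.pull (fun y => if y = u0 then u else y) k _ _ ?_ fun A hA => ?_
    · grind
    · rcases colp_cases hu0 hUX hu (h.mem A hA).2 (hU A hA) with h3 | h3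
      · left
        intro x hx y hy hxA hyA
        exact (h3.2 x hx hxA).trans (h3.2 y hy hyA).symm
      · right
        refine ⟨colp U u A, ⟨A, hA, rfl⟩, ?_⟩
        intro y hy
        rw [h3 _ (by grind)]
        split_ifs <;> grind
  · refine PP.pull (fun y => if y = u then u0 else y) k _ _ ?_ ?_
    · grind
    · rintro _ ⟨A, hA, rfl⟩
      rcases colp_cases hu0 hUX hu (h.mem A hA).2 (hU A hA) with h3 | h3
      · left
        intro x hx y hy hxA hyA
        exact (h3.1 x hx hxA).trans (h3.1 y hy hyA).symm
      · exact Or.inr ⟨A, hA, h3⟩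

lemma empty_case {X : Finset α} {u : α} {𝒞 : Set (Finset α)} (h : Two X 𝒞) (hu : u ∉ X) :
    rNum X 𝒞 = rNum ((X \ ∅) ∪ {u}) (collapseTo 𝒞 ∅ u) := by
  have hc : collapseTo 𝒞 ∅ u = 𝒞 := by
    ext D; simp [collapseTo]
  have hX : X \ ∅ ∪ {u} = X ∪ {u} := by simp
  rw [hc, hX]
  have h' : Two (X ∪ {u}) 𝒞 := by
    refine ⟨⟨u, by simp⟩, ?_, fun A hA => ⟨(h.mem A hA).1,
      (h.mem A hA).2.trans Finset.subset_union_left⟩⟩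
    obtain ⟨C1, C2, rfl, h1, h2⟩ := h.two
    have key : ∀ C ⊆ C1 ∪ C2, (∀ A ∈ C, ∀ B ∈ C, Cpt X A B) →
        ∀ A ∈ C, ∀ B ∈ C, Cpt (X ∪ {u}) A B := by
      intro C hs hC A hA B hB
      have hA1 := (h.mem A (hs hA)).2
      have hB1 := (h.mem B (hs hB)).2
      rcases hC A hA B hB with h3 | h3 | h3
      · exact Or.inl fun x hx hxA => h3 x (hA1 hxA) hxA
      · exact Or.inr (Or.inl fun x hx hxA => h3 x (hB1 hxA) hxA)
      · exact Or.inr (Or.inr fun x hx hxA => h3 x (hA1 hxA) hxA)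
    exact ⟨C1, C2, rfl, key _ Set.subset_union_left h1, key _ Set.subset_union_right h2⟩
  apply le_antisymm
  · exact h.le (h'.pp.subset Finset.subset_union_left)
  · apply h'.le
    refine PP.glue ?_ _ X (by simpa using hu) ?_ h.pp
    · intro A hA A' hA'
      exact Cpt.small _ (by simp)
    · intro A hA
      right; left
      intro x hx hxA
      rw [Finset.mem_singleton] at hx
      subst hx
      exact hu ((h.mem A hA).2 hxA)

theorem main_two {X U : Finset α} {u : α} {𝒞 : Set (Finset α)} (h : Two X 𝒞) (hUX : U ⊆ X)
    (hu : u ∉ X) (hU : Unseparated 𝒞 U) :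
    rNum X 𝒞 = rNum U (restrictTo 𝒞 U) + rNum ((X \ U) ∪ {u}) (collapseTo 𝒞 U u) := by
  rcases U.eq_empty_or_nonempty with rfl | ⟨u0, hu0⟩
  · rw [rNum_empty, zero_add]
    exact empty_case h hu
  have hr := restrictTo_two h hUX ⟨u0, hu0⟩
  have hc := collapseTo_two h hUX hu0 hu hU
  have hcpt : ∀ A ∈ 𝒞, Cpt X A U := by
    intro A hA
    rcases hU A hA with h1 | h1 | h1
    · right; right
      intro x hx hxA hxU
      have : x ∈ A ∩ U := Finset.mem_inter.2 ⟨hxA, hxU⟩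
      simp [h1] at this
    · exact Or.inl fun x _ hxA => h1 hxA
    · exact Or.inr (Or.inl fun x _ hxA => h1 hxA)
  apply le_antisymm
  · exact h.le (PP.join _ _ X U u0 hu0 hUX hcpt ((restrictTo_pp _).1 hr.pp)
      ((collapseTo_pp h hUX hu0 hu hU _).1 hc.pp))
  · obtain ⟨a, b, hab, ha, hb⟩ := PP.split _ X U u0 hu0 hUX hcpt h.pp
    exact (Nat.add_le_add (hr.le ((restrictTo_pp _).2 ha))
      (hc.le ((collapseTo_pp h hUX hu0 hu hU _).2 hb))).trans hab

/-- cluster decomposition.  For `𝒞 = Cl({T₁,T₂})` with `T₁, T₂` trees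
on `X` and `U ⊆ X` unseparated with respect to `𝒞`, and a new taxon `u ∉ X`:
`r(𝒞) = r(𝒞|U) + r(𝒞_{U→u})`. -/
theorem rNum_decomposition {α : Type} [DecidableEq α] (X : Finset α)
    (T₁ T₂ : Net α) (h₁ : IsPhyloTree X T₁) (h₂ : IsPhyloTree X T₂)
    (U : Finset α) (hUX : U ⊆ X) (hU : Unseparated (clSet T₁ ∪ clSet T₂) U)
    (u : α) (hu : u ∉ X) :
    rNum X (clSet T₁ ∪ clSet T₂) =
      rNum U (restrictTo (clSet T₁ ∪ clSet T₂) U) +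
        rNum ((X \ U) ∪ {u}) (collapseTo (clSet T₁ ∪ clSet T₂) U u) := by
  refine main_two ⟨net_nonempty h₁.1, ⟨_, _, rfl, clSet_laminar h₁, clSet_laminar h₂⟩, ?_⟩ hUX hu hU
  rintro A (⟨e, he, rfl⟩ | ⟨e, he, rfl⟩)
  · exact clusterBelow_mem h₁.1 _
  · exact clusterBelow_mem h₂.1 _

end Phylo
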